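/- arXiv:1807.10694 — 2 statements merged into one kernel-verified Lean document; each statement's English description precedes it below -/
import Mathlib

section
/- Let S ∈ 𝒮 be a pricing process. Then S satisfies the no-arbitrage condition (NA), i.e. [Σ_{s=0}^T Γ_s(S_s)] ∩ [−Γ_T(S_T)] ⊆ Γ_T(S_T), if and only if Q^e(S) ≠ ∅, i.e. there exists a probability measure Q equivalent to P under which S is a martingale (with (Q,S) ∈ Q_0^e). -/
open MeasureTheory Filter Set
open scoped ENNReal

noncomputable section

namespace RiskPaper

variable {Ω : Type*}

/-- Euclidean inner product on `Fin d → ℝ`. -/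
def dot {d : ℕ} (x y : Fin d → ℝ) : ℝ := ∑ i, x i * y i

/-- The first unit vector `e₁ = (1,0,…,0) ∈ ℝ^d`. -/
def e1 (d : ℕ) : Fin d → ℝ := fun i => if (i : ℕ) = 0 then 1 else 0

/-- The `i`-th unit vector of `ℝ^d`. -/
def eVec {d : ℕ} (i : Fin d) : Fin d → ℝ := fun j => if j = i then 1 else 0

/-- Measurability with respect to an explicitly given σ-algebra on the domain. -/
def MeasF {α : Type*} [MeasurableSpace α] (m : MeasurableSpace Ω) (f : Ω → α) : Prop :=
  @Measurable Ω α m _ f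

/-- `L^∞_d(F_t)`: bounded `F_t`-measurable `ℝ^d`-valued random variables
(pointwise representatives). -/
def LinfD (F : ℕ → MeasurableSpace Ω) (d t : ℕ) : Set (Ω → Fin d → ℝ) :=
  {X | MeasF (F t) X ∧ ∃ C : ℝ, ∀ ω i, |X ω i| ≤ C}

/-- `L^∞(F_t)`: bounded `F_t`-measurable scalar random variables. -/
def Linf (F : ℕ → MeasurableSpace Ω) (t : ℕ) : Set (Ω → ℝ) :=
  {x | MeasF (F t) x ∧ ∃ C : ℝ, ∀ ω, |x ω| ≤ C}

/-- The eligible space `M_t = L^∞(F_t) × {0}^{d-1}` (portfolios held in the first asset). -/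
def Mt (F : ℕ → MeasurableSpace Ω) (d t : ℕ) : Set (Ω → Fin d → ℝ) :=
  {m | m ∈ LinfD F d t ∧ ∀ ω, ∀ i : Fin d, (i : ℕ) ≠ 0 → m ω i = 0}

/-- The nonnegative elements `M_{t,+}` of `M_t`. -/
def MtPlus (F : ℕ → MeasurableSpace Ω) (d t : ℕ) : Set (Ω → Fin d → ℝ) :=
  {m | m ∈ Mt F d t ∧ ∀ ω i, 0 ≤ m ω i}

/-- Structural assumptions on the filtration `(F_t)_{t=0}^T`: increasing, contained in the
ambient σ-algebra, `F_T` equal to the ambient σ-algebra, and `F_0` `P`-trivial. -/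
def FiltrationOK [m0 : MeasurableSpace Ω] (F : ℕ → MeasurableSpace Ω) (P : Measure Ω)
    (T : ℕ) : Prop :=
  (∀ s t : ℕ, s ≤ t → F s ≤ F t) ∧ (∀ t, F t ≤ m0) ∧ F T = m0 ∧
    ∀ A : Set Ω, MeasurableSet[F 0] A → P A = 0 ∨ P A = 1

section Meas
variable [MeasurableSpace Ω]

/-- `g` is (a version of) the essential infimum of the set `A` of random variables. -/
def IsEssInfSet (P : Measure Ω) (A : Set (Ω → ℝ)) (g : Ω → ℝ) : Prop :=
  (∀ f ∈ A, ∀ᵐ ω ∂P, g ω ≤ f ω) ∧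
    ∀ h : Ω → ℝ, (∀ f ∈ A, ∀ᵐ ω ∂P, h ω ≤ f ω) → ∀ᵐ ω ∂P, h ω ≤ g ω

/-- `g` is (a version of) the essential supremum of the set `A` of random variables. -/
def IsEssSupSet (P : Measure Ω) (A : Set (Ω → ℝ)) (g : Ω → ℝ) : Prop :=
  (∀ f ∈ A, ∀ᵐ ω ∂P, f ω ≤ g ω) ∧
    ∀ h : Ω → ℝ, (∀ f ∈ A, ∀ᵐ ω ∂P, f ω ≤ h ω) → ∀ᵐ ω ∂P, g ω ≤ h ω

/-- Essential supremum of a set of extended-real-valued random variables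
(to accommodate the values `±∞`). -/
def IsEssSupSetE (P : Measure Ω) (A : Set (Ω → EReal)) (g : Ω → EReal) : Prop :=
  (∀ f ∈ A, ∀ᵐ ω ∂P, f ω ≤ g ω) ∧
    ∀ h : Ω → EReal, (∀ f ∈ A, ∀ᵐ ω ∂P, f ω ≤ h ω) → ∀ᵐ ω ∂P, g ω ≤ h ω

/-- Essential infimum of a set of extended-real-valued random variables. -/
def IsEssInfSetE (P : Measure Ω) (A : Set (Ω → EReal)) (g : Ω → EReal) : Prop :=
  (∀ f ∈ A, ∀ᵐ ω ∂P, g ω ≤ f ω) ∧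
    ∀ h : Ω → EReal, (∀ f ∈ A, ∀ᵐ ω ∂P, h ω ≤ f ω) → ∀ᵐ ω ∂P, h ω ≤ g ω

/-- An (extended-real-valued) random variable lies in `L^∞(F_t)`:
it agrees `P`-a.s. with a bounded `F_t`-measurable real random variable. -/
def MemLinfE (F : ℕ → MeasurableSpace Ω) (P : Measure Ω) (t : ℕ) (g : Ω → EReal) : Prop :=
  ∃ x ∈ Linf F t, g =ᵐ[P] fun ω => (x ω : EReal)

/-- The Radon–Nikodym density `dQ/dP` as a real random variable. -/
def rnd (P Q : Measure Ω) : Ω → ℝ := fun ω => (Q.rnDeriv P ω).toReal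

/-- `ξ̄_{t,T}(Q) = (dQ/dP)/E[dQ/dP | F_t]` on `{E[dQ/dP|F_t] > 0}` and `1` elsewhere. -/
def xiBar (F : ℕ → MeasurableSpace Ω) (P Q : Measure Ω) (t : ℕ) : Ω → ℝ := fun ω =>
  if 0 < (P[rnd P Q | F t]) ω then rnd P Q ω / (P[rnd P Q | F t]) ω else 1

/-- The `P`-a.s. version of the conditional expectation `E^Q[x | F_t]`, defined as
`E[ξ̄_{t,T}(Q) x | F_t]`. -/
def EQcond (F : ℕ → MeasurableSpace Ω) (P Q : Measure Ω) (t : ℕ) (x : Ω → ℝ) : Ω → ℝ :=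
  P[fun ω => xiBar F P Q t ω * x ω | F t]

end Meas

/-- The solvency regions are closed convex cones (pointwise in `ω`). -/
def ConesOK {d : ℕ} (K : ℕ → Ω → Set (Fin d → ℝ)) : Prop :=
  ∀ s (ω : Ω), IsClosed (K s ω) ∧ Convex ℝ (K s ω) ∧
    (0 : Fin d → ℝ) ∈ K s ω ∧ ∀ c : ℝ, 0 ≤ c → ∀ x ∈ K s ω, c • x ∈ K s ω

/-- The trading set `𝕂_t = Σ_{s=t}^T L^∞_d(F_s; K_s)`. -/
def KK (F : ℕ → MeasurableSpace Ω) (d T : ℕ) (K : ℕ → Ω → Set (Fin d → ℝ)) (t : ℕ) :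
    Set (Ω → Fin d → ℝ) :=
  {X | ∃ k : ℕ → Ω → Fin d → ℝ,
      (∀ s, t ≤ s → s ≤ T → k s ∈ LinfD F d s ∧ ∀ ω, k s ω ∈ K s ω) ∧
      ∀ ω, X ω = ∑ s ∈ Finset.Icc t T, k s ω}

/-- Assumption 2.2 of the paper: `K_T ⊇ K̄` a.s. for a convex cone `K̄` with
`int K̄ ⊇ ℝ^d_+ \ {0}`. -/
def FrictionAssumption [MeasurableSpace Ω] (P : Measure Ω) {d : ℕ} (T : ℕ)
    (K : ℕ → Ω → Set (Fin d → ℝ)) : Prop :=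
  ∃ Kbar : Set (Fin d → ℝ), Convex ℝ Kbar ∧
    (∀ c : ℝ, 0 ≤ c → ∀ x ∈ Kbar, c • x ∈ Kbar) ∧
    {x : Fin d → ℝ | (∀ i, 0 ≤ x i) ∧ x ≠ 0} ⊆ interior Kbar ∧
    ∀ᵐ ω ∂P, Kbar ⊆ K T ω

/-- The norm `‖x‖_{𝕂_T,0}` for a deterministic portfolio `x ∈ ℝ^d`:
`inf{c ∈ ℝ : c e₁ − x ∈ 𝕂_T, x + c e₁ ∈ 𝕂_T}`. -/
def normKT0 (F : ℕ → MeasurableSpace Ω) (d T : ℕ) (K : ℕ → Ω → Set (Fin d → ℝ))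
    (x : Fin d → ℝ) : ℝ :=
  sInf {c : ℝ | (fun (_ : Ω) i => c * e1 d i - x i) ∈ KK F d T K T ∧
      (fun (_ : Ω) i => x i + c * e1 d i) ∈ KK F d T K T}

/-- The positive dual cone of a set `C ⊆ ℝ^d`. -/
def dualCone {d : ℕ} (C : Set (Fin d → ℝ)) : Set (Fin d → ℝ) := {y | ∀ x ∈ C, 0 ≤ dot x y}

section MeasP
variable [MeasurableSpace Ω]

/-- The positive dual cone `𝕂_t^+ ⊆ L^1_d` of the trading set `𝕂_t`. -/
def KKplus (F : ℕ → MeasurableSpace Ω) (P : Measure Ω) (d T : ℕ)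
    (K : ℕ → Ω → Set (Fin d → ℝ)) (t : ℕ) : Set (Ω → Fin d → ℝ) :=
  {v | (∀ i : Fin d, Integrable (fun ω => v ω i) P) ∧
      ∀ u ∈ KK F d T K t, 0 ≤ ∫ ω, dot (v ω) (u ω) ∂P}

/-- `(Q,S) ∈ 𝒬_t`: `Q ≪ P` a probability measure and `(S_s)_{s=t}^T` a consistent pricing
process with `S_{s,1} ≡ 1`, the `L^∞` bound `‖S_{s,i}‖_∞ ≤ max{‖e_i‖_{𝕂_T,0},1}`,
`S_s = E^Q[S_T | F_s]` and `(dQ/dP) S_T ∈ 𝕂_t^+`. -/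
def memQt (F : ℕ → MeasurableSpace Ω) (P : Measure Ω) (d T : ℕ)
    (K : ℕ → Ω → Set (Fin d → ℝ)) (t : ℕ) (Q : Measure Ω) (S : ℕ → Ω → Fin d → ℝ) : Prop :=
  IsProbabilityMeasure Q ∧ Q ≪ P ∧
    (∀ s, t ≤ s → s ≤ T →
      S s ∈ LinfD F d s ∧
      (∀ ω, ∀ i : Fin d, (i : ℕ) = 0 → S s ω i = 1) ∧
      (∀ i : Fin d, ∀ ω, |S s ω i| ≤ max (normKT0 F d T K (eVec i)) 1) ∧
      ∀ i : Fin d, (fun ω => S s ω i) =ᵐ[P] EQcond F P Q s fun ω => S T ω i) ∧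
    (fun ω i => rnd P Q ω * S T ω i) ∈ KKplus F P d T K t

/-- `(Q,S) ∈ 𝒬_t^e`: additionally `Q` is equivalent to `P`. -/
def memQtE (F : ℕ → MeasurableSpace Ω) (P : Measure Ω) (d T : ℕ)
    (K : ℕ → Ω → Set (Fin d → ℝ)) (t : ℕ) (Q : Measure Ω) (S : ℕ → Ω → Fin d → ℝ) : Prop :=
  memQt F P d T K t Q S ∧ P ≪ Q

/-- The set `𝒮` of eligible (frictionless) pricing processes. -/
def memS (F : ℕ → MeasurableSpace Ω) (d T : ℕ) (K : ℕ → Ω → Set (Fin d → ℝ))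
    (S : ℕ → Ω → Fin d → ℝ) : Prop :=
  ∀ t ≤ T, S t ∈ LinfD F d t ∧ (∀ ω, S t ω ∈ dualCone (K t ω)) ∧
    (∀ ω, ∀ i : Fin d, (i : ℕ) = 0 → S t ω i = 1) ∧
    ∀ i : Fin d, ∀ ω, |S t ω i| ≤ max (normKT0 F d T K (eVec i)) 1

/-- `Q ∈ 𝒬^e(S)`: `Q` is a probability measure equivalent to `P` under which
`S` is a martingale (with the `P`-a.s. version of conditional expectations). -/
def QeS (F : ℕ → MeasurableSpace Ω) (P : Measure Ω) (d T : ℕ)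
    (S : ℕ → Ω → Fin d → ℝ) : Set (Measure Ω) :=
  {Q | IsProbabilityMeasure Q ∧ Q ≪ P ∧ P ≪ Q ∧
    ∀ s ≤ T, ∀ i : Fin d, (fun ω => S s ω i) =ᵐ[P] EQcond F P Q s fun ω => S T ω i}

/-- The cone `Γ_t(S_t) = {Z ∈ L^∞_d(F_t) : S_t^⊤ Z ≥ 0 a.s.}`. -/
def Gamma (F : ℕ → MeasurableSpace Ω) (P : Measure Ω) (d : ℕ)
    (S : ℕ → Ω → Fin d → ℝ) (t : ℕ) : Set (Ω → Fin d → ℝ) :=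
  {Z | Z ∈ LinfD F d t ∧ ∀ᵐ ω ∂P, 0 ≤ dot (S t ω) (Z ω)}

/-- The set `Σ_{s=0}^T Γ_s(S_s)` of claims attainable from zero. -/
def SumGamma (F : ℕ → MeasurableSpace Ω) (P : Measure Ω) (d T : ℕ)
    (S : ℕ → Ω → Fin d → ℝ) : Set (Ω → Fin d → ℝ) :=
  {X | ∃ Z : ℕ → Ω → Fin d → ℝ, (∀ s ≤ T, Z s ∈ Gamma F P d S s) ∧
      ∀ ω, X ω = ∑ s ∈ Finset.range (T + 1), Z s ω}

/-- The no-arbitrage condition (NA):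
`[Σ_{s=0}^T Γ_s(S_s)] ∩ [−Γ_T(S_T)] ⊆ Γ_T(S_T)`. -/
def NoArb (F : ℕ → MeasurableSpace Ω) (P : Measure Ω) (d T : ℕ)
    (S : ℕ → Ω → Fin d → ℝ) : Prop :=
  ∀ X ∈ SumGamma F P d T S, (fun ω => -X ω) ∈ Gamma F P d S T → X ∈ Gamma F P d S T

/-- `ρ_t` is a scalarized conditional convex risk measure: finite (`L^∞(F_t)`-valued),
conditionally cash invariant in the first asset, monotone, conditionally convex. -/
structure ScalarRM (F : ℕ → MeasurableSpace Ω) (P : Measure Ω) (d T t : ℕ)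
    (rho : (Ω → Fin d → ℝ) → Ω → ℝ) : Prop where
  finite : ∀ X ∈ LinfD F d T, ∃ g ∈ Linf F t, rho X =ᵐ[P] g
  cash : ∀ X ∈ LinfD F d T, ∀ m ∈ Linf F t,
    rho (fun ω => X ω + m ω • e1 d) =ᵐ[P] fun ω => rho X ω - m ω
  mono : ∀ X ∈ LinfD F d T, ∀ Y ∈ LinfD F d T,
    (∀ ω i, X ω i ≤ Y ω i) → rho Y ≤ᵐ[P] rho X
  convex : ∀ X ∈ LinfD F d T, ∀ Y ∈ LinfD F d T, ∀ lam ∈ Linf F t,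
    (∀ ω, lam ω ∈ Set.Icc (0 : ℝ) 1) →
    rho (fun ω => lam ω • X ω + (1 - lam ω) • Y ω) ≤ᵐ[P]
      fun ω => lam ω * rho X ω + (1 - lam ω) * rho Y ω

/-- Conditional positive homogeneity (coherence). -/
def CoherentRM (F : ℕ → MeasurableSpace Ω) (P : Measure Ω) (d T t : ℕ)
    (rho : (Ω → Fin d → ℝ) → Ω → ℝ) : Prop :=
  ∀ X ∈ LinfD F d T, ∀ lam ∈ Linf F t, (∀ ω, 0 ≤ lam ω) →
    rho (fun ω => lam ω • X ω) =ᵐ[P] fun ω => lam ω * rho X ω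

/-- `𝕂_t`-compatibility of a scalar risk measure:
`ρ_t(X) = essinf_{k ∈ 𝕂_t} ρ_t(X−k)`. -/
def KCompat (F : ℕ → MeasurableSpace Ω) (P : Measure Ω) (d T : ℕ)
    (K : ℕ → Ω → Set (Fin d → ℝ)) (t : ℕ) (rho : (Ω → Fin d → ℝ) → Ω → ℝ) : Prop :=
  ∀ X ∈ LinfD F d T,
    IsEssInfSet P {g | ∃ k ∈ KK F d T K t, g = rho fun ω => X ω - k ω} (rho X)

/-- The acceptance set `A_t = {X ∈ L^∞_d(F) : ρ_t(X) ≤ 0}`. -/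
def Acc (F : ℕ → MeasurableSpace Ω) (P : Measure Ω) (d T : ℕ)
    (rho : (Ω → Fin d → ℝ) → Ω → ℝ) : Set (Ω → Fin d → ℝ) :=
  {X | X ∈ LinfD F d T ∧ ∀ᵐ ω ∂P, rho X ω ≤ 0}

/-- `β` is (a version of) the penalty function
`β_t(Q,S) = esssup_{Z ∈ A} −E^Q[S_T^⊤ Z | F_t]`. -/
def IsPenalty (F : ℕ → MeasurableSpace Ω) (P : Measure Ω) (d T t : ℕ)
    (A : Set (Ω → Fin d → ℝ)) (Q : Measure Ω) (S : ℕ → Ω → Fin d → ℝ)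
    (beta : Ω → EReal) : Prop :=
  IsEssSupSetE P
    {g | ∃ Z ∈ A, g = fun ω =>
      ((-(EQcond F P Q t (fun ω' => dot (S T ω') (Z ω')) ω) : ℝ) : EReal)} beta

/-- `g` is (a version of) `π_t^S(X) = esssup_{Q ∈ 𝒬^e(S)} (−β_t(Q,S) − E^Q[S_T^⊤ X|F_t])`. -/
def IsPi (F : ℕ → MeasurableSpace Ω) (P : Measure Ω) (d T t : ℕ)
    (beta : Measure Ω → Ω → EReal) (S : ℕ → Ω → Fin d → ℝ) (X : Ω → Fin d → ℝ)
    (g : Ω → EReal) : Prop :=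
  IsEssSupSetE P
    {h | ∃ Q ∈ QeS F P d T S, h = fun ω =>
      -beta Q ω - ((EQcond F P Q t (fun ω' => dot (S T ω') (X ω')) ω : ℝ) : EReal)} g

/-- The Fatou property of `ρ_t`. -/
def Fatou (F : ℕ → MeasurableSpace Ω) (P : Measure Ω) (d T : ℕ)
    (rho : (Ω → Fin d → ℝ) → Ω → ℝ) : Prop :=
  ∀ X ∈ LinfD F d T, ∀ Xn : ℕ → Ω → Fin d → ℝ, (∀ n, Xn n ∈ LinfD F d T) →
    (∃ C : ℝ, ∀ n ω i, |Xn n ω i| ≤ C) →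
    (∀ᵐ ω ∂P, Tendsto (fun n => Xn n ω) atTop (nhds (X ω))) →
    ∀ᵐ ω ∂P, rho X ω ≤ atTop.liminf fun n => rho (Xn n) ω

/-- Relevance (sensitivity): `P(ρ_t(−ε 1_D e₁) > ρ_t(0)) > 0` for all `ε > 0` and all
`D ∈ F` with positive probability. -/
def Relevant (P : Measure Ω) (d : ℕ) (rho : (Ω → Fin d → ℝ) → Ω → ℝ) : Prop :=
  ∀ ε : ℝ, 0 < ε → ∀ D : Set Ω, MeasurableSet D → 0 < P D →
    0 < P {ω | rho (fun _ _ => 0) ω <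
      rho (fun ω' => (-(ε * D.indicator (fun _ => (1 : ℝ)) ω')) • e1 d) ω}

end MeasP

/-- One refinement step in the selection of a cluster point: if `ω ∈ R n` frequently, where
`u n ω` stays in a compact set, then balls of radius `ε` can be chosen measurably so that
`u n ω` still visits the ball frequently along `R`. -/
lemma exists_measurable_frequently_dist_lt {X : Type*} [PseudoMetricSpace X]
    [SecondCountableTopology X] [MeasurableSpace X] [OpensMeasurableSpace X]
    {m : MeasurableSpace Ω} {k : Set X} (hk : IsCompact k) {u : ℕ → Ω → X}
    (hu : ∀ n, Measurable (u n)) (huk : ∀ n ω, u n ω ∈ k) {R : ℕ → Set Ω}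
    (hR : ∀ n, MeasurableSet (R n)) (hfreq : ∀ ω, ∃ᶠ n in atTop, ω ∈ R n) {ε : ℝ} (hε : 0 < ε) :
    ∃ c : Ω → X, Measurable c ∧ ∀ ω, ∃ᶠ n in atTop, ω ∈ R n ∧ dist (u n ω) (c ω) < ε := by
  classical
  rcases isEmpty_or_nonempty X with hX | hX
  · exact ⟨fun ω => u 0 ω, hu 0, fun ω => (hX.false (u 0 ω)).elim⟩
  let q := TopologicalSpace.denseSeq X
  have hex : ∀ ω, ∃ j, ∃ᶠ n in atTop, ω ∈ R n ∧ dist (u n ω) (q j) < ε := by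
    intro ω
    obtain ⟨t, ht⟩ := hk.elim_finite_subcover (fun j => Metric.ball (q j) ε)
      (fun j => Metric.isOpen_ball) (fun x _ => by
        obtain ⟨j, hj⟩ := (TopologicalSpace.denseRange_denseSeq X).exists_dist_lt x hε
        exact mem_iUnion.2 ⟨j, hj⟩)
    by_contra! hcon
    have hev : ∀ᶠ n in atTop, ∀ j ∈ t, ω ∈ R n → ε ≤ dist (u n ω) (q j) :=
      (Finset.eventually_all t).2 fun j _ => hcon j
    obtain ⟨n, hn, hev⟩ := ((hfreq ω).and_eventually hev).exists
    obtain ⟨j, hj, hball⟩ := mem_iUnion₂.1 (ht (huk n ω))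
    exact (hev j hj hn).not_gt hball
  refine ⟨fun ω => q (Nat.find (hex ω)), ?_, fun ω => Nat.find_spec (hex ω)⟩
  refine Measurable.find (f := fun j _ => q j) (fun j => measurable_const) (fun j => ?_) hex
  have hset : {ω | ∃ᶠ n in atTop, ω ∈ R n ∧ dist (u n ω) (q j) < ε} =
      limsup (fun n => R n ∩ u n ⁻¹' Metric.ball (q j) ε) atTop := by
    ext ω
    simp [mem_limsup_iff_frequently_mem]
  rw [hset]
  exact MeasurableSet.measurableSet_limsup fun n =>
    (hR n).inter (hu n Metric.isOpen_ball.measurableSet)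

/-- A sequence of measurable maps into a compact set has a measurable pointwise cluster point. -/
lemma exists_measurable_mapClusterPt {X : Type*} [MetricSpace X] [CompleteSpace X]
    [SecondCountableTopology X] [MeasurableSpace X] [BorelSpace X]
    {m : MeasurableSpace Ω} {k : Set X} (hk : IsCompact k) {u : ℕ → Ω → X}
    (hu : ∀ n, Measurable (u n)) (huk : ∀ n ω, u n ω ∈ k) :
    ∃ c : Ω → X, Measurable c ∧ ∀ ω, MapClusterPt (c ω) atTop (fun n => u n ω) := by
  let St := {R : ℕ → Set Ω // (∀ n, MeasurableSet (R n)) ∧ ∀ ω, ∃ᶠ n in atTop, ω ∈ R n}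
  have step : ∀ (R : St) (j : ℕ), ∃ c : Ω → X, Measurable c ∧
      ∀ ω, ∃ᶠ n in atTop, ω ∈ R.1 n ∧ dist (u n ω) (c ω) < (1 / 2) ^ j := fun R j =>
    exists_measurable_frequently_dist_lt hk hu huk R.2.1 R.2.2 (by positivity)
  choose c hcm hcf using step
  let next : ℕ → St → St := fun j R =>
    ⟨fun n => R.1 n ∩ {ω | dist (u n ω) (c R j ω) < (1 / 2) ^ j},
      fun n => (R.2.1 n).inter (measurableSet_lt ((hu n).dist (hcm R j)) measurable_const),
      fun ω => hcf R j ω⟩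
  let R : ℕ → St := fun j => Nat.rec ⟨fun _ => univ, fun _ => MeasurableSet.univ,
    fun ω => Frequently.of_forall fun _ => mem_univ ω⟩ next j
  have hsucc : ∀ j, R (j + 1) = next j (R j) := fun j => rfl
  let e : ℕ → Ω → X := fun j => c (R j) j
  have hnear : ∀ j n ω, ω ∈ (R (j + 1)).1 n → dist (u n ω) (e j ω) < (1 / 2) ^ j :=
    fun j n ω h => by rw [hsucc] at h; exact h.2
  have hanti : ∀ j n, (R (j + 1)).1 n ⊆ (R j).1 n := fun j n ω h => by
    rw [hsucc] at h; exact h.1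
  have hdist : ∀ ω j, dist (e j ω) (e (j + 1) ω) ≤ 4 / 2 / 2 ^ j := by
    intro ω j
    obtain ⟨n, hn⟩ := ((R (j + 2)).2.2 ω).exists
    have h1 := hnear (j + 1) n ω hn
    have h2 := hnear j n ω (hanti (j + 1) n hn)
    have h3 := dist_triangle_left (e j ω) (e (j + 1) ω) (u n ω)
    have h4 : ((1 : ℝ) / 2) ^ (j + 1) ≤ (1 / 2) ^ j :=
      pow_le_pow_of_le_one (by norm_num) (by norm_num) (Nat.le_succ j)
    have h5 : (4 : ℝ) / 2 / 2 ^ j = 2 * (1 / 2) ^ j := by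
      rw [one_div, inv_pow]; ring
    rw [h5]; linarith
  have hlim : ∀ ω, ∃ x, Tendsto (fun j => e j ω) atTop (nhds x) := fun ω =>
    cauchySeq_tendsto_of_complete (cauchySeq_of_le_geometric_two (hdist ω))
  choose x hx using hlim
  refine ⟨x, measurable_of_tendsto_metrizable (fun j => hcm (R j) j) (tendsto_pi_nhds.2 hx),
    fun ω => mapClusterPt_iff_frequently.2 fun s hs => ?_⟩
  obtain ⟨ε, hε, hball⟩ := Metric.mem_nhds_iff.1 hs
  have hp : Tendsto (fun j : ℕ => ((1 : ℝ) / 2) ^ j) atTop (nhds 0) :=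
    tendsto_pow_atTop_nhds_zero_of_lt_one (by norm_num) (by norm_num)
  obtain ⟨j, hj1, hj2⟩ := ((hp.eventually_lt_const (half_pos hε)).and
    ((Metric.tendsto_nhds.1 (hx ω)) (ε / 2) (half_pos hε))).exists
  refine ((R (j + 1)).2.2 ω).mono fun n hn => hball ?_
  have h1 := hnear j n ω hn
  have h2 := dist_triangle (u n ω) (e j ω) (x ω)
  rw [Metric.mem_ball]
  linarith

section OnePeriod

variable {E : Type*} [NormedAddCommGroup E] [InnerProductSpace ℝ E]

/-- The closed subspace of square integrable `m`-measurable portfolios `η` with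
`⟪η, ξ⟫ = 0` almost surely. -/
def nullPortfolios {m m0 : MeasurableSpace Ω} (hm : m ≤ m0) (μ : Measure[m0] Ω) (ξ : Ω → E) :
    Submodule ℝ (Lp E 2 (μ.trim hm)) where
  carrier := {η | ∀ᵐ ω ∂μ, inner ℝ (η ω) (ξ ω) = 0}
  zero_mem' := by
    filter_upwards [ae_of_ae_trim hm (Lp.coeFn_zero E 2 (μ.trim hm))] with ω h
    change inner ℝ ((0 : Lp E 2 (μ.trim hm)) ω) (ξ ω) = 0
    rw [h, Pi.zero_apply, inner_zero_left]
  add_mem' {a b} ha hb := by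
    filter_upwards [ha, hb, ae_of_ae_trim hm (Lp.coeFn_add a b)] with ω h1 h2 h3
    rw [h3, Pi.add_apply, inner_add_left, h1, h2, add_zero]
  smul_mem' c a ha := by
    filter_upwards [ha, ae_of_ae_trim hm (Lp.coeFn_smul c a)] with ω h1 h3
    rw [h3, Pi.smul_apply, inner_smul_left, h1, mul_zero]

lemma isClosed_nullPortfolios {m m0 : MeasurableSpace Ω} (hm : m ≤ m0) (μ : Measure[m0] Ω)
    (ξ : Ω → E) : IsClosed (nullPortfolios hm μ ξ : Set (Lp E 2 (μ.trim hm))) := by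
  refine IsSeqClosed.isClosed fun a b ha hab => ?_
  obtain ⟨φ, -, hφ⟩ := (tendstoInMeasure_of_tendsto_Lp hab).exists_seq_tendsto_ae
  have hall : ∀ᵐ ω ∂μ, ∀ n, inner ℝ (a n ω) (ξ ω) = 0 := ae_all_iff.2 ha
  change ∀ᵐ ω ∂μ, inner ℝ (b ω) (ξ ω) = 0
  filter_upwards [hall, ae_of_ae_trim hm hφ] with ω h1 h2
  refine tendsto_nhds_unique (h2.inner tendsto_const_nhds) ?_
  simp [h1]

variable [FiniteDimensional ℝ E] [MeasurableSpace E] [BorelSpace E]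

/-- Every portfolio has the same gain as one which is orthogonal to all null portfolios. -/
lemma exists_orthogonal_portfolio {m m0 : MeasurableSpace Ω} (hm : m ≤ m0) (μ : Measure[m0] Ω)
    [IsFiniteMeasure μ] (ξ : Ω → E) {θ : Ω → E} (hθ : Measurable[m] θ)
    (hθb : ∃ C, ∀ ω, ‖θ ω‖ ≤ C) :
    ∃ t : Ω → E, Measurable[m] t ∧ (∀ᵐ ω ∂μ, inner ℝ (t ω) (ξ ω) = inner ℝ (θ ω) (ξ ω)) ∧
      ∀ η : Ω → E, Measurable[m] η → (∃ C, ∀ ω, ‖η ω‖ ≤ C) →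
        (∀ᵐ ω ∂μ, inner ℝ (η ω) (ξ ω) = 0) → ∀ᵐ ω ∂μ, inner ℝ (t ω) (η ω) = 0 := by
  set N := nullPortfolios hm μ ξ with hN
  have hcl : IsClosed (N : Set (Lp E 2 (μ.trim hm))) := isClosed_nullPortfolios hm μ ξ
  have : CompleteSpace N := hcl.completeSpace_coe
  have hmem : ∀ η : Ω → E, Measurable[m] η → (∃ C, ∀ ω, ‖η ω‖ ≤ C) →
      MemLp η 2 (μ.trim hm) := fun η hη ⟨C, hC⟩ =>
    MemLp.of_bound (StronglyMeasurable.aestronglyMeasurable (hη.stronglyMeasurable)) C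
      (Eventually.of_forall hC)
  have hθ2 := hmem θ hθ hθb
  set a := hθ2.toLp θ with ha
  set b := a - N.starProjection a with hb
  have hborth : ∀ η ∈ N, inner ℝ b η = 0 := fun η hη =>
    N.starProjection_inner_eq_zero a η hη
  refine ⟨b, (Lp.stronglyMeasurable b).measurable, ?_, ?_⟩
  · have hp : ∀ᵐ ω ∂μ, inner ℝ ((N.starProjection a : Lp E 2 (μ.trim hm)) ω) (ξ ω) = 0 :=
      N.starProjection_apply_mem a
    filter_upwards [hp, ae_of_ae_trim hm (Lp.coeFn_sub a (N.starProjection a)),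
      ae_of_ae_trim hm hθ2.coeFn_toLp] with ω h1 h2 h3
    rw [hb, h2, Pi.sub_apply, inner_sub_left, h1, sub_zero, ha, h3]
  · intro η hη hηb hnull
    refine ae_of_ae_trim hm ?_
    have hη2 := hmem η hη hηb
    have hint : Integrable (fun ω => inner ℝ (b ω) (η ω)) (μ.trim hm) :=
      (L2.integrable_inner b (hη2.toLp η)).congr (by
        filter_upwards [hη2.coeFn_toLp] with ω h
        rw [h])
    refine hint.ae_eq_zero_of_forall_setIntegral_eq_zero fun s hs _ => ?_
    obtain ⟨C, hC⟩ := hηb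
    have hηs : Measurable[m] (s.indicator η) := hη.indicator hs
    have hηs2 : MemLp (s.indicator η) 2 (μ.trim hm) := hη2.indicator hs
    have hsN : hηs2.toLp _ ∈ N := by
      change ∀ᵐ ω ∂μ, inner ℝ (hηs2.toLp _ ω) (ξ ω) = 0
      filter_upwards [hnull, ae_of_ae_trim hm hηs2.coeFn_toLp] with ω h1 h2
      rw [h2]
      by_cases hω : ω ∈ s <;> simp [hω, h1]
    have := hborth _ hsN
    rw [L2.inner_def] at this
    rw [← this, ← integral_indicator hs]
    refine integral_congr_ae ?_
    filter_upwards [hηs2.coeFn_toLp] with ω h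
    rw [h]
    by_cases hω : ω ∈ s <;> simp [hω]

/-- There is no asymptotic arbitrage: if gains of bounded portfolios dominate a sequence converging
to `g ≥ 0`, then `g` vanishes. -/
lemma ae_eq_zero_of_tendsto_of_le_gain {m m0 : MeasurableSpace Ω} (hm : m ≤ m0)
    (μ : Measure[m0] Ω) [IsFiniteMeasure μ] (ξ : Ω → E)
    (hNA : ∀ θ : Ω → E, Measurable[m] θ → (∃ C, ∀ ω, ‖θ ω‖ ≤ C) →
      (∀ᵐ ω ∂μ, 0 ≤ inner ℝ (θ ω) (ξ ω)) → ∀ᵐ ω ∂μ, inner ℝ (θ ω) (ξ ω) = 0)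
    {θ : ℕ → Ω → E} (hθ : ∀ n, Measurable[m] (θ n)) (hθb : ∀ n, ∃ C, ∀ ω, ‖θ n ω‖ ≤ C)
    {f : ℕ → Ω → ℝ} {g : Ω → ℝ} (hf : ∀ n, ∀ᵐ ω ∂μ, f n ω ≤ inner ℝ (θ n ω) (ξ ω))
    (hfg : ∀ᵐ ω ∂μ, Tendsto (fun n => f n ω) atTop (nhds (g ω))) (hg : ∀ᵐ ω ∂μ, 0 ≤ g ω) :
    ∀ᵐ ω ∂μ, g ω = 0 := by
  choose t htm htξ htorth using fun n => exists_orthogonal_portfolio hm μ ξ (hθ n) (hθb n)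
  let r : ℕ → Ω → ℝ := fun n ω => (1 + ‖t n ω‖)⁻¹
  have hrm : ∀ n, Measurable[m] (r n) := fun n =>
    (by fun_prop : Measurable fun x : E => (1 + ‖x‖)⁻¹).comp (htm n)
  have hr0 : ∀ n ω, 0 < r n ω := fun n ω => by positivity
  have hr1 : ∀ n ω, r n ω + ‖r n ω • t n ω‖ = 1 := fun n ω => by
    rw [norm_smul, Real.norm_of_nonneg (hr0 n ω).le, ← mul_one_add]
    exact inv_mul_cancel₀ (by positivity)
  let u : ℕ → Ω → ℝ × E := fun n ω => (r n ω, r n ω • t n ω)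
  have hum : ∀ n, Measurable[m] (u n) := fun n => (hrm n).prodMk (Measurable.smul (hrm n) (htm n))
  have huk : ∀ n ω, u n ω ∈ Metric.closedBall (0 : ℝ × E) 1 := fun n ω => by
    rw [mem_closedBall_zero_iff, Prod.norm_def, max_le_iff]
    have h1 := hr1 n ω
    have h2 := hr0 n ω
    have h3 := norm_nonneg (r n ω • t n ω)
    refine ⟨?_, ?_⟩
    · change ‖r n ω‖ ≤ 1
      rw [Real.norm_of_nonneg h2.le]; linarith
    · change ‖r n ω • t n ω‖ ≤ 1
      linarith
  obtain ⟨c, hcm, hc⟩ := exists_measurable_mapClusterPt (isCompact_closedBall (0 : ℝ × E) 1) hum huk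
  choose φ hφmono hφ using fun ω => (hc ω).tendsto_subseq
  have hφr : ∀ ω, Tendsto (fun k => r (φ ω k) ω) atTop (nhds (c ω).1) := fun ω =>
    (continuous_fst.tendsto _).comp (hφ ω)
  have hφt : ∀ ω, Tendsto (fun k => r (φ ω k) ω • t (φ ω k) ω) atTop (nhds (c ω).2) := fun ω =>
    (continuous_snd.tendsto _).comp (hφ ω)
  have hc0 : ∀ ω, 0 ≤ (c ω).1 := fun ω => ge_of_tendsto' (hφr ω) fun k => (hr0 _ ω).le
  have hc1 : ∀ ω, (c ω).1 + ‖(c ω).2‖ = 1 := fun ω => by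
    refine tendsto_nhds_unique ((hφr ω).add (hφt ω).norm) ?_
    simp [hr1]
  have hcb : ∃ C, ∀ ω, ‖(c ω).2‖ ≤ C := ⟨1, fun ω => by linarith [hc0 ω, hc1 ω]⟩
  have hcm2 : Measurable[m] fun ω => (c ω).2 := measurable_snd.comp hcm
  have hdom : ∀ᵐ ω ∂μ, (c ω).1 * g ω ≤ inner ℝ (c ω).2 (ξ ω) := by
    filter_upwards [ae_all_iff.2 hf, ae_all_iff.2 htξ, hfg] with ω h1 h2 h3
    refine le_of_tendsto_of_tendsto' ((hφr ω).mul (h3.comp (hφmono ω).tendsto_atTop))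
      ((hφt ω).inner tendsto_const_nhds) fun k => ?_
    rw [real_inner_smul_left, h2]
    exact mul_le_mul_of_nonneg_left (h1 _) (hr0 _ ω).le
  have hnull := hNA (fun ω => (c ω).2) hcm2 hcb (by
    filter_upwards [hdom, hg] with ω h1 h2
    exact (mul_nonneg (hc0 ω) h2).trans h1)
  have horth := ae_all_iff.2 fun n => htorth n (fun ω => (c ω).2) hcm2 hcb hnull
  filter_upwards [hdom, hnull, horth, hg] with ω h1 h2 h3 h4
  have h5 : inner ℝ (c ω).2 (c ω).2 = (0 : ℝ) := by
    refine tendsto_nhds_unique ((hφt ω).inner tendsto_const_nhds) ?_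
    simp [real_inner_smul_left, h3]
  have h6 : (c ω).1 = 1 := by
    have := hc1 ω
    rwa [inner_self_eq_zero.1 h5, norm_zero, add_zero] at this
  rw [h2, h6, one_mul] at h1
  exact le_antisymm h1 h4

/-- **Halmos–Savage exhaustion**: a closed cone of nonnegative square integrable functions that
charges every set of positive measure contains an almost surely positive element. -/
lemma exists_mem_properCone_ae_pos [MeasurableSpace Ω] {μ : Measure Ω} [IsFiniteMeasure μ]
    (K : ProperCone ℝ (Lp ℝ 2 μ)) (hK0 : ∀ y ∈ K, 0 ≤ y)
    (hK : ∀ A, MeasurableSet A → μ A ≠ 0 → ∃ y ∈ K, 0 < ∫ ω in A, y ω ∂μ) :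
    ∃ y ∈ K, ∀ᵐ ω ∂μ, 0 < y ω := by
  let p : Lp ℝ 2 μ → ℝ := fun y => μ.real {ω | 0 < y ω}
  have hmeas : ∀ y : Lp ℝ 2 μ, MeasurableSet {ω | 0 < y ω} := fun y =>
    measurableSet_lt measurable_const (Lp.stronglyMeasurable y).measurable
  have hmono : ∀ y z : Lp ℝ 2 μ, y ≤ z → p y ≤ p z := fun y z h => by
    refine ENNReal.toReal_mono (measure_ne_top _ _) (measure_mono_ae ?_)
    filter_upwards [(Lp.coeFn_le y z).2 h] with ω h1 h2
    exact lt_of_lt_of_le h2 h1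
  have hscale : ∀ (c : ℝ) (y : Lp ℝ 2 μ), 0 < c → p y ≤ p (c • y) := fun c y hc => by
    refine ENNReal.toReal_mono (measure_ne_top _ _) (measure_mono_ae ?_)
    filter_upwards [Lp.coeFn_smul c y] with ω h1 h2
    change 0 < (c • y : Lp ℝ 2 μ) ω
    rw [h1]
    exact mul_pos hc h2
  have hbdd : BddAbove (p '' K) :=
    ⟨μ.real univ, by rintro _ ⟨y, -, rfl⟩; exact measureReal_mono (subset_univ _)⟩
  obtain ⟨a, -, hatend, ha⟩ := exists_seq_tendsto_sSup (S := p '' K)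
    ⟨_, 0, K.zero_mem, rfl⟩ hbdd
  choose y hyK hya using ha
  let c : ℕ → ℝ := fun n => (1 / 2) ^ n * (1 + ‖y n‖)⁻¹
  have hc : ∀ n, 0 < c n := fun n => by positivity
  let w : ℕ → Lp ℝ 2 μ := fun n => c n • y n
  have hwK : ∀ n, w n ∈ K := fun n => K.smul_mem (hyK n) (hc n).le
  have hwsum : Summable w := by
    refine Summable.of_norm_bounded (g := fun n => (1 / 2 : ℝ) ^ n) summable_geometric_two
      fun n => ?_
    rw [norm_smul, Real.norm_of_nonneg (hc n).le, mul_assoc]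
    refine mul_le_of_le_one_right (by positivity) ?_
    rw [inv_mul_le_one₀ (by positivity)]
    linarith
  have hYK : ∑' n, w n ∈ K :=
     K.isClosed.mem_of_tendsto hwsum.hasSum
      (Eventually.of_forall fun s => sum_mem fun n _ => hwK n)
  refine ⟨∑' n, w n, hYK, ?_⟩
  have hsup : sSup (p '' K) ≤ p (∑' n, w n) := le_of_tendsto' hatend fun n => by
    rw [← hya n]
    exact (hscale _ _ (hc n)).trans (hmono _ _ (hwsum.le_tsum n fun j _ => hK0 _ (hwK j)))
  by_contra hcon
  set Y := ∑' n, w n with hY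
  have hA : μ {ω | 0 < Y ω}ᶜ ≠ 0 := fun h => hcon h
  obtain ⟨z, hzK, hz⟩ := hK _ (hmeas Y).compl hA
  have hz0 : 0 < μ.real ({ω | 0 < Y ω}ᶜ ∩ {ω | 0 < z ω}) := by
    rw [measureReal_def, ENNReal.toReal_pos_iff]
    refine ⟨pos_iff_ne_zero.2 fun h => hz.not_ge ?_, measure_lt_top _ _⟩
    refine setIntegral_nonpos_ae (hmeas Y).compl ?_
    filter_upwards [measure_eq_zero_iff_ae_notMem.1 h] with ω h1 h2
    exact not_lt.1 fun h3 => h1 ⟨h2, h3⟩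
  have hYz : p Y + μ.real ({ω | 0 < Y ω}ᶜ ∩ {ω | 0 < z ω}) ≤ p (Y + z) := by
    rw [← measureReal_union (disjoint_compl_right.mono_right inter_subset_left)
      ((hmeas Y).compl.inter (hmeas z))]
    refine ENNReal.toReal_mono (measure_ne_top _ _) (measure_mono_ae ?_)
    filter_upwards [Lp.coeFn_add Y z, (Lp.coeFn_nonneg Y).2 (hK0 Y hYK),
      (Lp.coeFn_nonneg z).2 (hK0 z hzK)] with ω h1 h2 h3 h4
    change 0 < (Y + z : Lp ℝ 2 μ) ω
    rw [h1]
    rcases h4 with h4 | h4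
    · exact add_pos_of_pos_of_nonneg h4 h3
    · exact add_pos_of_nonneg_of_pos h2 h4.2
  have := le_csSup hbdd ⟨Y + z, K.add_mem hYK hzK, rfl⟩
  linarith

/-- The cone of claims `f` in `L²` whose negative `-f` is superhedged at zero cost by a bounded
`m`-measurable portfolio. -/
def hedgeableCone (m : MeasurableSpace Ω) {m0 : MeasurableSpace Ω} (μ : Measure[m0] Ω) (ξ : Ω → E) :
    PointedCone ℝ (Lp ℝ 2 μ) where
  carrier := {f | ∃ θ : Ω → E, Measurable[m] θ ∧ (∃ C, ∀ ω, ‖θ ω‖ ≤ C) ∧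
    ∀ᵐ ω ∂μ, 0 ≤ inner ℝ (θ ω) (ξ ω) + f ω}
  add_mem' := by
    rintro f g ⟨θ, hθ, ⟨C, hC⟩, hf⟩ ⟨η, hη, ⟨D, hD⟩, hg⟩
    refine ⟨fun ω => θ ω + η ω, Measurable.add hθ hη,
      ⟨C + D, fun ω => (norm_add_le _ _).trans (add_le_add (hC ω) (hD ω))⟩, ?_⟩
    filter_upwards [hf, hg, Lp.coeFn_add f g] with ω h1 h2 h3
    change 0 ≤ _ + (f + g : Lp ℝ 2 μ) ω
    rw [h3, inner_add_left, Pi.add_apply]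
    linarith
  zero_mem' := by
    refine ⟨fun _ => 0, measurable_const, ⟨0, fun ω => by simp⟩, ?_⟩
    filter_upwards [Lp.coeFn_zero ℝ 2 μ] with ω h
    change 0 ≤ _ + (0 : Lp ℝ 2 μ) ω
    rw [h, inner_zero_left, Pi.zero_apply, add_zero]
  smul_mem' := by
    rintro c f ⟨θ, hθ, ⟨C, hC⟩, hf⟩
    refine ⟨fun ω => (c : ℝ) • θ ω, Measurable.const_smul hθ (c : ℝ),
      ⟨c * C, fun ω => ?_⟩, ?_⟩
    · rw [norm_smul, Real.norm_of_nonneg c.2]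
      exact mul_le_mul_of_nonneg_left (hC ω) c.2
    filter_upwards [hf, Lp.coeFn_smul (c : ℝ) f] with ω h1 h2
    change 0 ≤ _ + ((c : ℝ) • f : Lp ℝ 2 μ) ω
    rw [h2, inner_smul_left, Pi.smul_apply, smul_eq_mul]
    simp only [conj_trivial]
    rw [← mul_add]
    exact mul_nonneg c.2 h1

/-- **One-period fundamental theorem of asset pricing**: absence of arbitrage yields a strictly
positive density under which every gain has zero expectation. -/
theorem exists_pos_density_integral_gain_eq_zero {m m0 : MeasurableSpace Ω} (hm : m ≤ m0)
    (μ : Measure[m0] Ω) [IsFiniteMeasure μ] (ξ : Ω → E) (hξ : Measurable[m0] ξ)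
    (hξb : ∃ C, ∀ ω, ‖ξ ω‖ ≤ C)
    (hNA : ∀ θ : Ω → E, Measurable[m] θ → (∃ C, ∀ ω, ‖θ ω‖ ≤ C) →
      (∀ᵐ ω ∂μ, 0 ≤ inner ℝ (θ ω) (ξ ω)) → ∀ᵐ ω ∂μ, inner ℝ (θ ω) (ξ ω) = 0) :
    ∃ Y : Ω → ℝ, Measurable[m0] Y ∧ (∀ ω, 0 < Y ω) ∧ Integrable Y μ ∧
      ∀ θ : Ω → E, Measurable[m] θ → (∃ C, ∀ ω, ‖θ ω‖ ≤ C) →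
        ∫ ω, Y ω * inner ℝ (θ ω) (ξ ω) ∂μ = 0 := by
  let D := hedgeableCone m μ ξ
  let K : ProperCone ℝ (Lp ℝ 2 μ) := ProperCone.innerDual (D : Set (Lp ℝ 2 μ))
  have hinner : ∀ f y : Lp ℝ 2 μ, inner ℝ f y = ∫ ω, y ω * f ω ∂μ := fun f y => by
    rw [L2.inner_def]; rfl
  have hK : ∀ y, y ∈ K ↔ ∀ f ∈ D, 0 ≤ ∫ ω, y ω * f ω ∂μ := fun y => by
    rw [ProperCone.mem_innerDual]
    simp only [hinner]
    rfl
  have hind : ∀ (A : Set Ω) (hA : MeasurableSet[m0] A) (y : Lp ℝ 2 μ),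
      inner ℝ (indicatorConstLp 2 hA (measure_ne_top μ A) (1 : ℝ)) y = ∫ ω in A, y ω ∂μ :=
    fun A hA y => L2.inner_indicatorConstLp_one hA _ y
  have hK0 : ∀ y ∈ K, 0 ≤ y := fun y hy => by
    rw [← Lp.coeFn_nonneg]
    refine ae_nonneg_of_forall_setIntegral_nonneg
      ((Lp.memLp y).integrable one_le_two) fun A hA _ => ?_
    rw [← hind A hA, hinner]
    refine (hK y).1 hy _ ⟨fun _ => 0, measurable_const, ⟨0, fun ω => by simp⟩, ?_⟩
    filter_upwards [indicatorConstLp_coeFn (p := 2) (hs := hA) (hμs := measure_ne_top μ A)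
      (c := (1 : ℝ))] with ω h
    rw [h, inner_zero_left, zero_add]
    exact indicator_nonneg (fun _ _ => zero_le_one) _
  have hgainb : ∀ θ : Ω → E, Measurable[m] θ → (∃ C, ∀ ω, ‖θ ω‖ ≤ C) →
      MemLp (fun ω => inner ℝ (θ ω) (ξ ω)) 2 μ := by
    rintro θ hθ ⟨C, hC⟩
    obtain ⟨C', hC'⟩ := hξb
    refine MemLp.of_bound (((hθ.mono hm le_rfl).inner hξ).aestronglyMeasurable) (C * C')
      (ae_of_all _ fun ω => (norm_inner_le_norm _ _).trans ?_)
    exact mul_le_mul (hC ω) (hC' ω) (norm_nonneg _) ((norm_nonneg _).trans (hC ω))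
  have hgain : ∀ y ∈ K, ∀ θ : Ω → E, Measurable[m] θ → (∃ C, ∀ ω, ‖θ ω‖ ≤ C) →
      0 ≤ ∫ ω, y ω * inner ℝ (θ ω) (ξ ω) ∂μ := by
    rintro y hy θ hθ hθb
    have h1 := (hK y).1 hy ((hgainb θ hθ hθb).toLp) ⟨fun ω => -θ ω, Measurable.neg hθ,
      by simpa using hθb, ?_⟩
    · refine h1.trans_eq (integral_congr_ae ?_)
      filter_upwards [(hgainb θ hθ hθb).coeFn_toLp] with ω h
      rw [h]
    · filter_upwards [(hgainb θ hθ hθb).coeFn_toLp] with ω h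
      rw [h, inner_neg_left]
      simp
  have hcharge : ∀ A, MeasurableSet[m0] A → μ A ≠ 0 → ∃ y ∈ K, 0 < ∫ ω in A, y ω ∂μ := by
    intro A hA hμA
    let e : Lp ℝ 2 μ := indicatorConstLp 2 hA (measure_ne_top μ A) (1 : ℝ)
    have he : e =ᵐ[μ] A.indicator fun _ => 1 := indicatorConstLp_coeFn
    have hmem : -e ∉ closure (D : Set (Lp ℝ 2 μ)) := by
      intro hcl
      obtain ⟨f, hfD, hf⟩ := mem_closure_iff_seq_limit.1 hcl
      have htm : TendstoInMeasure μ (fun n => (f n : Ω → ℝ)) atTop (-e : Lp ℝ 2 μ) :=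
        tendstoInMeasure_of_tendsto_Lp hf
      obtain ⟨ns, -, hns⟩ := htm.exists_seq_tendsto_ae
      choose θ hθ hθb hθf using hfD
      have h0 := ae_eq_zero_of_tendsto_of_le_gain hm μ ξ hNA
        (θ := fun n => θ (ns n)) (fun n => hθ _) (fun n => hθb _)
        (f := fun n ω => -f (ns n) ω) (g := e)
        (fun n => by
          filter_upwards [hθf (ns n)] with ω h
          linarith)
        (by
          filter_upwards [hns, Lp.coeFn_neg e] with ω h1 h2
          rw [h2] at h1
          simpa using h1.neg)
        (by
          filter_upwards [he] with ω h
          rw [h]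
          exact indicator_nonneg (fun _ _ => zero_le_one) _)
      refine hμA (measure_eq_zero_iff_ae_notMem.2 ?_)
      filter_upwards [h0, he] with ω h1 h2 h3
      rw [h2, indicator_of_mem h3] at h1
      exact one_ne_zero h1
    obtain ⟨y, hy1, hy2⟩ := ProperCone.hyperplane_separation'
      (C := ⟨PointedCone.closure D, isClosed_closure⟩) (x₀ := -e) hmem
    refine ⟨y, fun f hf => hy1 f (subset_closure hf), ?_⟩
    rw [← hind A hA]
    rw [inner_neg_left] at hy2
    exact neg_neg_iff_pos.1 hy2
  obtain ⟨y, hyK, hy⟩ := exists_mem_properCone_ae_pos K hK0 hcharge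
  have hyint : Integrable y μ := (Lp.memLp y).integrable one_le_two
  let Y : Ω → ℝ := fun ω => if 0 < y ω then y ω else 1
  have hYy : Y =ᵐ[μ] y := by
    filter_upwards [hy] with ω h
    exact if_pos h
  have hym := (Lp.stronglyMeasurable y).measurable
  refine ⟨Y, Measurable.ite (measurableSet_lt measurable_const hym) hym measurable_const,
    fun ω => ?_, hyint.congr hYy.symm, fun θ hθ hθb => ?_⟩
  · by_cases h : 0 < y ω <;> simp [Y, h]
  have h1 := hgain y hyK θ hθ hθb
  have h2 := hgain y hyK (fun ω => -θ ω) (Measurable.neg hθ) (by simpa using hθb)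
  simp only [inner_neg_left, mul_neg, integral_neg] at h2
  rw [← le_antisymm (by linarith) h1]
  refine integral_congr_ae ?_
  filter_upwards [hYy] with ω h
  rw [h]

/-- An integral vanishing against all truncations `min (Y ω) n` of a weight `Y` vanishes against
`Y` itself. -/
lemma integral_mul_eq_zero_of_forall_min {m0 : MeasurableSpace Ω} {μ : Measure Ω} {Y g : Ω → ℝ}
    (hY : Integrable Y μ) (hY0 : ∀ ω, 0 < Y ω) (hg : AEStronglyMeasurable g μ)
    (hgb : ∃ C, ∀ ω, |g ω| ≤ C) (h : ∀ n : ℕ, ∫ ω, min (Y ω) n * g ω ∂μ = 0) :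
    ∫ ω, Y ω * g ω ∂μ = 0 := by
  obtain ⟨C, hC⟩ := hgb
  have ht : Tendsto (fun n : ℕ => ∫ ω, min (Y ω) n * g ω ∂μ) atTop
      (nhds (∫ ω, Y ω * g ω ∂μ)) := by
    refine tendsto_integral_of_dominated_convergence (fun ω => Y ω * C)
      (fun n => (hY.aestronglyMeasurable.inf aestronglyMeasurable_const).mul hg)
      (hY.mul_const C) (fun n => ae_of_all _ fun ω => ?_) (ae_of_all _ fun ω => ?_)
    · rw [norm_mul, Real.norm_of_nonneg (le_min (hY0 ω).le n.cast_nonneg)]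
      exact mul_le_mul (min_le_left _ _) (hC ω) (norm_nonneg _) (hY0 ω).le
    · refine tendsto_const_nhds.congr' ?_
      filter_upwards [eventually_ge_atTop ⌈Y ω⌉₊] with n hn
      rw [min_eq_left (Nat.ceil_le.1 hn)]
  simp only [h] at ht
  exact tendsto_nhds_unique ht tendsto_const_nhds

/-- **Dalang–Morton–Willinger theorem**, backward induction: a bounded adapted process without
one-period arbitrage admits an equivalent finite measure under which its increments are orthogonal
to all bounded predictable strategies over the last `k` periods. -/
theorem exists_equivalent_measure_integral_gain_eq_zero [m0 : MeasurableSpace Ω]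
    {F : ℕ → MeasurableSpace Ω} (hmono : Monotone F) (hle : ∀ t, F t ≤ m0) (P : Measure Ω)
    [IsFiniteMeasure P] {T : ℕ} {X : ℕ → Ω → E} (hX : ∀ t ≤ T, Measurable[F t] (X t))
    (hXb : ∀ t ≤ T, ∃ C, ∀ ω, ‖X t ω‖ ≤ C)
    (hNA : ∀ s < T, ∀ θ : Ω → E, Measurable[F s] θ → (∃ C, ∀ ω, ‖θ ω‖ ≤ C) →
      (∀ᵐ ω ∂P, 0 ≤ inner ℝ (θ ω) (X (s + 1) ω - X s ω)) →
        ∀ᵐ ω ∂P, inner ℝ (θ ω) (X (s + 1) ω - X s ω) = 0) {k : ℕ} (hk : k ≤ T) :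
    ∃ Q : Measure Ω, IsFiniteMeasure Q ∧ Q ≪ P ∧ P ≪ Q ∧ ∀ s, T - k ≤ s → s < T →
      ∀ θ : Ω → E, Measurable[F s] θ → (∃ C, ∀ ω, ‖θ ω‖ ≤ C) →
        ∫ ω, inner ℝ (θ ω) (X (s + 1) ω - X s ω) ∂Q = 0 := by
  have hΔm : ∀ s < T, Measurable[F (s + 1)] fun ω => X (s + 1) ω - X s ω := fun s hs =>
    Measurable.sub (hX (s + 1) hs) ((hX s hs.le).mono (hmono s.le_succ) le_rfl)
  have hΔb : ∀ s < T, ∃ C, ∀ ω, ‖X (s + 1) ω - X s ω‖ ≤ C := fun s hs => by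
    obtain ⟨C, hC⟩ := hXb (s + 1) hs
    obtain ⟨D, hD⟩ := hXb s hs.le
    exact ⟨C + D, fun ω => (norm_sub_le _ _).trans (add_le_add (hC ω) (hD ω))⟩
  have hgm : ∀ s < T, ∀ θ : Ω → E, Measurable[F s] θ →
      Measurable[F (s + 1)] fun ω => inner ℝ (θ ω) (X (s + 1) ω - X s ω) := fun s hs θ hθ =>
    (by fun_prop : Measurable fun x : E × E => inner ℝ x.1 x.2).comp
      ((hθ.mono (hmono s.le_succ) le_rfl).prodMk (hΔm s hs))
  induction k with
  | zero => exact ⟨P, inferInstance, .rfl, .rfl, fun s h1 h2 => absurd h2 (by omega)⟩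
  | succ k ih =>
    obtain ⟨Q, hQ, hQP, hPQ, hQT⟩ := ih (by omega)
    obtain ⟨u, hu⟩ : ∃ u, T = u + (k + 1) := ⟨T - (k + 1), by omega⟩
    have huT : u < T := by omega
    obtain ⟨Y, hYm, hY0, hYint, hY⟩ := exists_pos_density_integral_gain_eq_zero
      (hmono u.le_succ) (Q.trim (hle (u + 1))) _ (hΔm u huT) (hΔb u huT)
      (fun θ hθ hθb h0 => by
        have hms : MeasurableSet[F (u + 1)]
            {ω | ¬inner ℝ (θ ω) (X (u + 1) ω - X u ω) = 0} :=
          MeasurableSet.compl (hgm u huT θ hθ (measurableSet_singleton 0))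
        rw [ae_iff, trim_measurableSet_eq _ hms, ← ae_iff]
        exact hQP.ae_le (hNA u huT θ hθ hθb (hPQ.ae_le (ae_of_ae_trim (hle (u + 1)) h0))))
    have hYQ : Integrable Y Q := integrable_of_integrable_trim (hle _) hYint
    have hYm0 : Measurable[m0] Y := hYm.mono (hle _) le_rfl
    refine ⟨Q.withDensity fun ω => ENNReal.ofReal (Y ω),
      isFiniteMeasure_withDensity_ofReal hYQ.2, (withDensity_absolutelyContinuous _ _).trans hQP,
      hPQ.trans (withDensity_absolutelyContinuous' hYm0.ennreal_ofReal.aemeasurable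
        (ae_of_all _ fun ω => (ENNReal.ofReal_pos.2 (hY0 ω)).ne')), fun s hs hsT θ hθ hθb => ?_⟩
    rw [integral_withDensity_eq_integral_toReal_smul hYm0.ennreal_ofReal
      (ae_of_all _ fun _ => ENNReal.ofReal_lt_top)]
    simp only [ENNReal.toReal_ofReal (hY0 _).le, smul_eq_mul]
    have hgm' := hgm s hsT θ hθ
    rcases (show u ≤ s by omega).eq_or_lt with rfl | hus
    · rw [← hY θ hθ hθb, ← integral_trim (hle (u + 1))]
      exact (Measurable.mul hYm hgm').stronglyMeasurable
    · refine integral_mul_eq_zero_of_forall_min hYQ hY0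
        (hgm'.mono (hle _) le_rfl).aestronglyMeasurable ?_ fun n => ?_
      · obtain ⟨C, hC⟩ := hθb
        obtain ⟨D, hD⟩ := hΔb s hsT
        exact ⟨C * D, fun ω => (abs_real_inner_le_norm _ _).trans
          (mul_le_mul (hC ω) (hD ω) (norm_nonneg _) ((norm_nonneg _).trans (hC ω)))⟩
      · obtain ⟨C, hC⟩ := hθb
        have hmin : Measurable[F s] fun ω => min (Y ω) n :=
          Measurable.min (hYm.mono (hmono hus) le_rfl) measurable_const
        have := hQT s (by omega) hsT (fun ω => min (Y ω) n • θ ω) (Measurable.smul hmin hθ)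
          ⟨n * C, fun ω => by
            rw [norm_smul, Real.norm_of_nonneg (le_min (hY0 ω).le n.cast_nonneg)]
            exact mul_le_mul (min_le_right _ _) (hC ω) (norm_nonneg _) n.cast_nonneg⟩
        simpa only [inner_smul_left, conj_trivial] using this

end OnePeriod

section ChangeOfMeasure
variable [m0 : MeasurableSpace Ω] {F : ℕ → MeasurableSpace Ω} {P Q : Measure Ω}
  [IsProbabilityMeasure P] [IsProbabilityMeasure Q] {s : ℕ}

lemma setLIntegral_ofReal_condExp_rnd (hF : F s ≤ m0) (hQP : Q ≪ P) {A : Set Ω}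
    (hA : MeasurableSet[F s] A) :
    ∫⁻ ω in A, ENNReal.ofReal ((P[rnd P Q | F s]) ω) ∂P = Q A := by
  have hD : Integrable (rnd P Q) P := Measure.integrable_toReal_rnDeriv
  rw [← ofReal_integral_eq_lintegral_ofReal integrable_condExp.integrableOn
    (ae_restrict_of_ae
      (condExp_nonneg (f := rnd P Q) (ae_of_all _ fun _ => ENNReal.toReal_nonneg))),
    setIntegral_condExp hF hD hA]
  unfold rnd
  rw [Measure.setIntegral_toReal_rnDeriv hQP, ofReal_measureReal]

lemma condExp_rnd_pos (hF : F s ≤ m0) (hQP : Q ≪ P) (hPQ : P ≪ Q) :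
    ∀ᵐ ω ∂P, 0 < (P[rnd P Q | F s]) ω := by
  have hA : MeasurableSet[F s] {ω | ¬ 0 < (P[rnd P Q | F s]) ω} :=
    MeasurableSet.compl (stronglyMeasurable_condExp.measurable measurableSet_Ioi)
  refine ae_iff.2 (hPQ ?_)
  rw [← setLIntegral_ofReal_condExp_rnd hF hQP hA, setLIntegral_congr_fun (g := 0) (hF _ hA)
    fun ω hω => ENNReal.ofReal_of_nonpos (not_lt.1 hω)]
  simp

lemma integrable_inv_condExp_rnd (hF : F s ≤ m0) (hQP : Q ≪ P) :
    Integrable (fun ω => ((P[rnd P Q | F s]) ω)⁻¹) Q := by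
  set M := P[rnd P Q | F s] with hM
  have hMm : Measurable[F s] M := stronglyMeasurable_condExp.measurable
  have hMm0 : Measurable[m0] M := hMm.mono hF le_rfl
  have htrim : Q.trim hF = (P.withDensity fun ω => ENNReal.ofReal (M ω)).trim hF := by
    refine @Measure.ext _ (F s) _ _ fun A hA => ?_
    rw [trim_measurableSet_eq hF hA, trim_measurableSet_eq hF hA,
      withDensity_apply _ (hF _ hA), setLIntegral_ofReal_condExp_rnd hF hQP hA]
  refine ⟨hMm0.inv.aestronglyMeasurable, ?_⟩
  have hg : Measurable[F s] fun ω => ‖(M ω)⁻¹‖ₑ :=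
    (by fun_prop : Measurable fun x : ℝ => ‖x⁻¹‖ₑ).comp hMm
  have h0 : ∀ᵐ ω ∂P, 0 ≤ M ω :=
    condExp_nonneg (ae_of_all _ fun _ => ENNReal.toReal_nonneg)
  rw [HasFiniteIntegral, ← lintegral_trim hF hg, htrim, lintegral_trim hF hg,
    lintegral_withDensity_eq_lintegral_mul _ hMm0.ennreal_ofReal (hg.mono hF le_rfl)]
  refine lt_of_le_of_lt (lintegral_mono_ae (g := fun _ => 1) ?_) (by simp)
  filter_upwards [h0] with ω h
  rw [Pi.mul_apply, Real.enorm_of_nonneg (inv_nonneg.2 h),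
    ← ENNReal.ofReal_mul h, ENNReal.ofReal_le_one]
  exact mul_inv_le_one

/-- **Bayes formula**: `EQcond` is a version of the conditional expectation under `Q`. -/
theorem EQcond_ae_eq_condExp (hF : F s ≤ m0) (hQP : Q ≪ P) (hPQ : P ≪ Q) {f : Ω → ℝ}
    (hf : Measurable f) (hfb : ∃ C, ∀ ω, |f ω| ≤ C) :
    EQcond F P Q s f =ᵐ[P] Q[f | F s] := by
  obtain ⟨C, hC⟩ := hfb
  set D := rnd P Q with hD
  set M := P[D | F s] with hM
  set h := Q[f | F s] with hh
  have hDint : Integrable D P := Measure.integrable_toReal_rnDeriv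
  have hM0 : ∀ᵐ ω ∂P, 0 < M ω := condExp_rnd_pos hF hQP hPQ
  have hMinv : Integrable (fun ω => (M ω)⁻¹) Q := integrable_inv_condExp_rnd hF hQP
  have hMm : StronglyMeasurable[F s] fun ω => (M ω)⁻¹ :=
    (Measurable.inv (stronglyMeasurable_condExp (f := D) (μ := P)).measurable).stronglyMeasurable
  have hfint : Integrable f Q := .of_bound hf.aestronglyMeasurable C (ae_of_all _ hC)
  have hMf : Integrable (fun ω => (M ω)⁻¹ * f ω) Q :=
    hMinv.mul_bdd hf.aestronglyMeasurable (ae_of_all _ hC)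
  have hpullQ : Q[fun ω => (M ω)⁻¹ * f ω | F s] =ᵐ[Q] fun ω => (M ω)⁻¹ * h ω :=
    condExp_mul_of_stronglyMeasurable_left hMm hMf hfint
  have hMh : Integrable (fun ω => (M ω)⁻¹ * h ω) Q := integrable_condExp.congr hpullQ
  have hpullP : P[fun ω => ((M ω)⁻¹ * h ω) * D ω | F s] =ᵐ[P]
      fun ω => ((M ω)⁻¹ * h ω) * M ω :=
    condExp_mul_of_stronglyMeasurable_left (hMm.mul stronglyMeasurable_condExp)
      (((integrable_rnDeriv_smul_iff hQP).2 hMh).congr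
        (ae_of_all _ fun ω => mul_comm _ _)) hDint
  have hξ : (fun ω => xiBar F P Q s ω * f ω) =ᵐ[P] fun ω => D ω * ((M ω)⁻¹ * f ω) := by
    filter_upwards [hM0] with ω h0
    rw [xiBar, if_pos h0]
    ring
  have hξint : Integrable (fun ω => xiBar F P Q s ω * f ω) P :=
    ((integrable_rnDeriv_smul_iff hQP).2 hMf).congr hξ.symm
  have hhP : (fun ω => D ω * ((M ω)⁻¹ * h ω)) =ᵐ[P] fun ω => ((M ω)⁻¹ * h ω) * D ω :=
    ae_of_all _ fun ω => mul_comm _ _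
  have hhint : Integrable h P := by
    refine integrable_condExp.congr (hpullP.trans ?_)
    filter_upwards [hM0] with ω h0
    field_simp
  refine (ae_eq_condExp_of_forall_setIntegral_eq hF hξint (fun _ _ _ => hhint.integrableOn)
    (fun A hA _ => ?_) stronglyMeasurable_condExp.aestronglyMeasurable).symm
  calc ∫ ω in A, h ω ∂P = ∫ ω in A, (P[fun ω => ((M ω)⁻¹ * h ω) * D ω | F s]) ω ∂P := by
        refine setIntegral_congr_ae (hF _ hA) ?_
        filter_upwards [hpullP, hM0] with ω h1 h2 _
        rw [h1]
        field_simp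
    _ = ∫ ω in A, D ω * ((M ω)⁻¹ * h ω) ∂P := by
        rw [setIntegral_condExp hF _ hA]
        · exact setIntegral_congr_fun (hF _ hA) fun ω _ => mul_comm _ _
        · exact ((integrable_rnDeriv_smul_iff hQP).2 hMh).congr hhP
    _ = ∫ ω in A, (M ω)⁻¹ * h ω ∂Q := setIntegral_rnDeriv_smul hQP (hF _ hA)
    _ = ∫ ω in A, (Q[fun ω => (M ω)⁻¹ * f ω | F s]) ω ∂Q :=
        setIntegral_congr_ae (hF _ hA) (hpullQ.symm.mono fun _ h _ => h)
    _ = ∫ ω in A, (M ω)⁻¹ * f ω ∂Q := setIntegral_condExp hF hMf hA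
    _ = ∫ ω in A, D ω * ((M ω)⁻¹ * f ω) ∂P := (setIntegral_rnDeriv_smul hQP (hF _ hA)).symm
    _ = ∫ ω in A, xiBar F P Q s ω * f ω ∂P :=
        setIntegral_congr_ae (hF _ hA) (hξ.symm.mono fun _ h _ => h)

end ChangeOfMeasure

section BoundedPortfolios
variable {F : ℕ → MeasurableSpace Ω} {d s t T : ℕ} {X Y : Ω → Fin d → ℝ}

lemma dot_eq_dotProduct (x y : Fin d → ℝ) : dot x y = x ⬝ᵥ y := rfl

lemma dot_e1 (hd : 0 < d) {x : Fin d → ℝ} (hx : ∀ i : Fin d, (i : ℕ) = 0 → x i = 1) :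
    dot x (e1 d) = 1 := by
  rw [dot, Finset.sum_eq_single_of_mem (⟨0, hd⟩ : Fin d) (Finset.mem_univ _)]
  · simp [e1, hx]
  · intro i _ hi
    have : (i : ℕ) ≠ 0 := fun h => hi (Fin.ext h)
    simp [e1, this]

lemma LinfD.mono (h : F s ≤ F t) (hX : X ∈ LinfD F d s) : X ∈ LinfD F d t :=
  ⟨hX.1.mono h le_rfl, hX.2⟩

lemma LinfD.zero : (fun _ => 0) ∈ LinfD F d t :=
  ⟨measurable_const, 0, fun ω i => by simp⟩

lemma LinfD.sub (hX : X ∈ LinfD F d t) (hY : Y ∈ LinfD F d t) :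
    (fun ω => X ω - Y ω) ∈ LinfD F d t := by
  obtain ⟨hXm, C, hC⟩ := hX
  obtain ⟨hYm, D, hD⟩ := hY
  exact ⟨Measurable.sub hXm hYm, C + D,
    fun ω i => (abs_sub _ _).trans (add_le_add (hC ω i) (hD ω i))⟩

lemma LinfD.apply (hX : X ∈ LinfD F d t) (i : Fin d) : (fun ω => X ω i) ∈ Linf F t :=
  ⟨(measurable_pi_apply i).comp hX.1, hX.2.imp fun _ h ω => h ω i⟩

lemma LinfD.dot (hX : X ∈ LinfD F d t) (hY : Y ∈ LinfD F d t) :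
    (fun ω => dot (X ω) (Y ω)) ∈ Linf F t := by
  obtain ⟨hXm, C, hC⟩ := hX
  obtain ⟨hYm, D, hD⟩ := hY
  refine ⟨Finset.measurable_fun_sum _ fun i _ =>
    Measurable.mul ((measurable_pi_apply i).comp hXm) ((measurable_pi_apply i).comp hYm),
    ∑ _i : Fin d, C * D, fun ω => (Finset.abs_sum_le_sum_abs _ _).trans
      (Finset.sum_le_sum fun i _ => ?_)⟩
  rw [abs_mul]
  exact mul_le_mul (hC ω i) (hD ω i) (abs_nonneg _) ((abs_nonneg _).trans (hC ω i))

lemma LinfD.smul_e1 {a : Ω → ℝ} (ha : a ∈ Linf F t) : (fun ω => a ω • e1 d) ∈ LinfD F d t := by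
  obtain ⟨ham, C, hC⟩ := ha
  refine ⟨Measurable.smul ham measurable_const, C, fun ω i => ?_⟩
  by_cases hi : (i : ℕ) = 0
  · simpa [e1, hi] using hC ω
  · simpa [e1, hi] using (abs_nonneg _).trans (hC ω)

lemma Linf.integrable [m0 : MeasurableSpace Ω] {Q : Measure Ω} [IsFiniteMeasure Q]
    (hF : F t ≤ m0) {a : Ω → ℝ} (ha : a ∈ Linf F t) : Integrable a Q := by
  obtain ⟨ham, C, hC⟩ := ha
  exact .of_bound (ham.mono hF le_rfl).aestronglyMeasurable C (ae_of_all _ hC)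

lemma LinfD.measurable_toLp (hX : X ∈ LinfD F d t) :
    Measurable[F t] fun ω => WithLp.toLp 2 (X ω) :=
  (by fun_prop : Measurable fun x : Fin d → ℝ => WithLp.toLp 2 x).comp hX.1

lemma LinfD.norm_toLp_le (hX : X ∈ LinfD F d t) : ∃ C, ∀ ω, ‖WithLp.toLp 2 (X ω)‖ ≤ C := by
  obtain ⟨-, C, hC⟩ := hX
  refine ⟨√(∑ _i : Fin d, C ^ 2), fun ω => ?_⟩
  rw [EuclideanSpace.norm_eq]
  refine Real.sqrt_le_sqrt (Finset.sum_le_sum fun i _ => ?_)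
  rw [Real.norm_eq_abs]
  exact pow_le_pow_left₀ (abs_nonneg _) (hC ω i) 2

lemma LinfD.of_euclidean {θ : Ω → EuclideanSpace ℝ (Fin d)} (hθ : Measurable[F t] θ)
    (hθb : ∃ C, ∀ ω, ‖θ ω‖ ≤ C) : (fun ω => (θ ω).ofLp) ∈ LinfD F d t := by
  obtain ⟨C, hC⟩ := hθb
  exact ⟨(by fun_prop : Measurable fun x : EuclideanSpace ℝ (Fin d) => x.ofLp).comp hθ, C,
    fun ω i => (PiLp.norm_apply_le (θ ω) i).trans (hC ω)⟩

end BoundedPortfolios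

section FundamentalTheorem
variable [m0 : MeasurableSpace Ω] {F : ℕ → MeasurableSpace Ω} {P : Measure Ω} {d T : ℕ}
  {S : ℕ → Ω → Fin d → ℝ}

/-- Under (NA) no one-period strategy yields a nontrivial nonnegative gain. -/
lemma NoArb.ae_gain_eq_zero (hNA : NoArb F P d T S) (hF : Monotone F)
    (hS : ∀ t ≤ T, S t ∈ LinfD F d t)
    (hS1 : ∀ t ≤ T, ∀ ω, ∀ i : Fin d, (i : ℕ) = 0 → S t ω i = 1) {s : ℕ} (hs : s < T)
    {θ : Ω → Fin d → ℝ} (hθ : θ ∈ LinfD F d s)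
    (h0 : ∀ᵐ ω ∂P, 0 ≤ dot (θ ω) (S (s + 1) ω - S s ω)) :
    ∀ᵐ ω ∂P, dot (θ ω) (S (s + 1) ω - S s ω) = 0 := by
  rcases d.eq_zero_or_pos with rfl | hd
  · exact ae_of_all _ fun ω => by simp [dot]
  let W : ℕ → Ω → Fin d → ℝ := fun t ω => θ ω - dot (S t ω) (θ ω) • e1 d
  have hW : ∀ t, s ≤ t → t ≤ T → W t ∈ LinfD F d t := fun t hst htT =>
    LinfD.sub (LinfD.mono (hF hst) hθ)
      (LinfD.smul_e1 (LinfD.dot (hS t htT) (LinfD.mono (hF hst) hθ)))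
  have hSW : ∀ t ≤ T, ∀ r ≤ T, ∀ ω,
      dot (S r ω) (W t ω) = dot (S r ω) (θ ω) - dot (S t ω) (θ ω) := fun t ht r hr ω => by
    have := dot_e1 hd (hS1 r hr ω)
    simp only [dot_eq_dotProduct, W, dotProduct_sub, dotProduct_smul] at this ⊢
    rw [this, smul_eq_mul, mul_one]
  let X : Ω → Fin d → ℝ := fun ω => W (s + 1) ω - W s ω
  have hX : ∀ ω, dot (S T ω) (X ω) = -dot (θ ω) (S (s + 1) ω - S s ω) := fun ω => by
    have h1 := hSW (s + 1) hs T le_rfl ω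
    have h2 := hSW s hs.le T le_rfl ω
    simp only [dot_eq_dotProduct, X, dotProduct_sub] at h1 h2 ⊢
    rw [h1, h2, dotProduct_comm (θ ω), dotProduct_comm (θ ω)]
    ring
  have hXS : X ∈ SumGamma F P d T S := by
    refine ⟨fun r ω => (if r = s + 1 then W (s + 1) ω else 0) - if r = s then W s ω else 0,
      fun r hr => ?_, fun ω => ?_⟩
    · rcases eq_or_ne r (s + 1) with rfl | h1
      · simp only [if_true, Nat.succ_ne_self, if_false, sub_zero]
        exact ⟨hW _ s.le_succ hr, ae_of_all _ fun ω => by rw [hSW _ hr _ hr, sub_self]⟩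
      rcases eq_or_ne r s with rfl | h2
      · simp only [h1, if_true, if_false]
        refine ⟨LinfD.sub LinfD.zero (hW _ le_rfl hr), ae_of_all _ fun ω => ?_⟩
        have := hSW _ hr _ hr ω
        simp only [dot_eq_dotProduct, zero_sub, dotProduct_neg] at this ⊢
        rw [this, sub_self, neg_zero]
      · simp only [h1, h2, if_false, sub_zero]
        exact ⟨LinfD.zero, ae_of_all _ fun ω => by simp [dot]⟩
    · rw [Finset.sum_sub_distrib, Finset.sum_ite_eq', Finset.sum_ite_eq',
        if_pos (Finset.mem_range.2 (by omega)), if_pos (Finset.mem_range.2 (by omega))]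
  have hXT : X ∈ LinfD F d T := LinfD.sub (LinfD.mono (hF hs) (hW _ s.le_succ hs))
    (LinfD.mono (hF hs.le) (hW _ le_rfl hs.le))
  have h1 := hNA X hXS ⟨by simpa using LinfD.sub LinfD.zero hXT, by
    filter_upwards [h0] with ω h
    have h2 := hX ω
    simp only [dot_eq_dotProduct, dotProduct_neg] at h h2 ⊢
    rwa [h2, neg_neg]⟩
  filter_upwards [h0, h1.2] with ω h2 h3
  rw [hX] at h3
  linarith

/-- A measure orthogonal to all one-period gains makes `S` a martingale. -/
lemma condExp_ae_eq_of_integral_gain_eq_zero (hF : Monotone F) (hle : ∀ t, F t ≤ m0)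
    (hS : ∀ t ≤ T, S t ∈ LinfD F d t) {Q : Measure Ω} [IsFiniteMeasure Q]
    (hQ : ∀ s < T, ∀ θ : Ω → EuclideanSpace ℝ (Fin d), Measurable[F s] θ →
      (∃ C, ∀ ω, ‖θ ω‖ ≤ C) →
        ∫ ω, inner ℝ (θ ω) (WithLp.toLp 2 (S (s + 1) ω) - WithLp.toLp 2 (S s ω)) ∂Q = 0)
    {s : ℕ} (hs : s ≤ T) (i : Fin d) :
    Q[fun ω => S T ω i | F s] =ᵐ[Q] fun ω => S s ω i := by
  have hint : ∀ t ≤ T, Integrable (fun ω => S t ω i) Q := fun t ht =>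
    Linf.integrable (hle t) (LinfD.apply (hS t ht) i)
  refine (ae_eq_condExp_of_forall_setIntegral_eq (hle s) (hint T le_rfl)
    (fun _ _ _ => (hint s hs).integrableOn) (fun A hA _ => ?_)
    (Measurable.stronglyMeasurable (LinfD.apply (hS s hs) i).1).aestronglyMeasurable).symm
  have key : ∀ r, s ≤ r → r ≤ T → ∫ ω in A, S s ω i ∂Q = ∫ ω in A, S r ω i ∂Q := by
    intro r hsr
    induction r, hsr using Nat.le_induction with
    | base => exact fun _ => rfl
    | succ r hsr ih =>
      intro hr
      rw [ih (by omega), eq_comm, ← sub_eq_zero,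
        ← integral_sub (hint _ hr).integrableOn (hint _ (by omega)).integrableOn,
        ← integral_indicator (hle _ _ hA)]
      have := hQ r hr (A.indicator fun _ => EuclideanSpace.single i 1)
        (Measurable.indicator measurable_const (hF hsr _ hA)) ⟨1, fun ω => by
          refine (norm_indicator_le_norm_self _ _).trans ?_
          simp⟩
      rw [← this]
      refine integral_congr_ae (ae_of_all _ fun ω => ?_)
      by_cases hω : ω ∈ A
      · simp [hω, EuclideanSpace.inner_single_left]
      · simp [hω]
  exact key T hs le_rfl

/-- Under an equivalent martingale measure the terminal value of an `F_s`-measurable portfolio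
has the same expectation as its value at time `s`. -/
lemma integral_dot_eq_of_condExp_ae_eq {Q : Measure Ω} [IsFiniteMeasure Q]
    (hle : ∀ t, F t ≤ m0) (hS : ∀ t ≤ T, S t ∈ LinfD F d t) {s : ℕ} (hs : s ≤ T)
    (hQ : ∀ i : Fin d, Q[fun ω => S T ω i | F s] =ᵐ[Q] fun ω => S s ω i)
    {Z : Ω → Fin d → ℝ} (hZ : Z ∈ LinfD F d s) :
    ∫ ω, dot (S T ω) (Z ω) ∂Q = ∫ ω, dot (S s ω) (Z ω) ∂Q := by
  have hint : ∀ t ≤ T, ∀ i, Integrable (fun ω => S t ω i * Z ω i) Q := fun t ht i => by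
    obtain ⟨hm, C, hC⟩ := LinfD.apply hZ i
    exact (Linf.integrable (hle t) (LinfD.apply (hS t ht) i)).mul_bdd
      (hm.mono (hle s) le_rfl).aestronglyMeasurable (ae_of_all _ hC)
  simp only [dot]
  rw [integral_finsetSum _ fun i _ => hint T le_rfl i,
    integral_finsetSum _ fun i _ => hint s hs i]
  refine Finset.sum_congr rfl fun i _ => ?_
  rw [← integral_condExp (hle s)]
  refine integral_congr_ae ?_
  filter_upwards [condExp_mul_of_stronglyMeasurable_right (m := F s)
    (Measurable.stronglyMeasurable (LinfD.apply hZ i).1) (hint T le_rfl i)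
    (Linf.integrable (hle T) (LinfD.apply (hS T le_rfl) i)), hQ i] with ω h1 h2
  exact h1.trans (by rw [Pi.mul_apply, h2])

/-- An equivalent martingale measure excludes arbitrage. -/
lemma noArb_of_condExp_ae_eq {Q : Measure Ω} [IsFiniteMeasure Q] (hQP : Q ≪ P) (hPQ : P ≪ Q)
    (hF : Monotone F) (hle : ∀ t, F t ≤ m0) (hS : ∀ t ≤ T, S t ∈ LinfD F d t)
    (hQ : ∀ s ≤ T, ∀ i : Fin d, Q[fun ω => S T ω i | F s] =ᵐ[Q] fun ω => S s ω i) :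
    NoArb F P d T S := by
  rintro X ⟨Z, hZ, hXZ⟩ ⟨hXm, hX⟩
  have hXL : X ∈ LinfD F d T := by simpa using LinfD.sub LinfD.zero hXm
  refine ⟨hXL, ?_⟩
  have hsum : ∀ ω, dot (S T ω) (X ω) = ∑ s ∈ Finset.range (T + 1), dot (S T ω) (Z s ω) :=
    fun ω => by rw [hXZ]; exact dotProduct_sum _ _ _
  have hlt : ∀ s ∈ Finset.range (T + 1), s ≤ T := fun s hs =>
    Nat.lt_succ_iff.1 (Finset.mem_range.1 hs)
  have hpos : 0 ≤ ∫ ω, dot (S T ω) (X ω) ∂Q := by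
    simp only [hsum]
    rw [integral_finsetSum _ fun s hs => Linf.integrable (hle T)
      (LinfD.dot (hS T le_rfl) (LinfD.mono (hF (hlt s hs)) (hZ s (hlt s hs)).1))]
    refine Finset.sum_nonneg fun s hs => ?_
    rw [integral_dot_eq_of_condExp_ae_eq hle hS (hlt s hs) (hQ s (hlt s hs)) (hZ s (hlt s hs)).1]
    exact integral_nonneg_of_ae (hQP.ae_le (hZ s (hlt s hs)).2)
  have hneg : ∀ ω, dot (S T ω) (-X ω) = -dot (S T ω) (X ω) := fun ω => dotProduct_neg _ _
  simp only [hneg] at hX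
  have h0 := (integral_eq_zero_iff_of_nonneg_ae (hQP.ae_le hX)
    (Linf.integrable (hle T) (LinfD.dot (hS T le_rfl) hXL)).neg).1 <| le_antisymm
      (by rw [integral_neg]; linarith) (integral_nonneg_of_ae (hQP.ae_le hX))
  filter_upwards [hPQ.ae_le h0] with ω h
  exact (neg_eq_zero.1 h).ge

/-- (NA) yields an equivalent martingale measure. -/
lemma NoArb.exists_condExp_ae_eq [IsProbabilityMeasure P] (hNA : NoArb F P d T S)
    (hF : Monotone F) (hle : ∀ t, F t ≤ m0) (hS : ∀ t ≤ T, S t ∈ LinfD F d t)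
    (hS1 : ∀ t ≤ T, ∀ ω, ∀ i : Fin d, (i : ℕ) = 0 → S t ω i = 1) :
    ∃ Q : Measure Ω, IsProbabilityMeasure Q ∧ Q ≪ P ∧ P ≪ Q ∧
      ∀ s ≤ T, ∀ i : Fin d, Q[fun ω => S T ω i | F s] =ᵐ[Q] fun ω => S s ω i := by
  obtain ⟨Q, hQfin, hQP, hPQ, hQ⟩ := exists_equivalent_measure_integral_gain_eq_zero hF hle P
    (X := fun t ω => WithLp.toLp 2 (S t ω)) (fun t ht => LinfD.measurable_toLp (hS t ht))
    (fun t ht => LinfD.norm_toLp_le (hS t ht)) (fun s hs θ hθ hθb h0 => by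
      have hinner : ∀ ω, inner ℝ (θ ω) (WithLp.toLp 2 (S (s + 1) ω) - WithLp.toLp 2 (S s ω)) =
          dot (θ ω).ofLp (S (s + 1) ω - S s ω) := fun ω => by
        simp [PiLp.inner_apply, dot, mul_comm]
      simp only [hinner] at h0 ⊢
      exact hNA.ae_gain_eq_zero hF hS hS1 hs (LinfD.of_euclidean hθ hθb) h0) le_rfl
  have hQ0 : NeZero Q := ⟨fun h => IsProbabilityMeasure.ne_zero P (by
    rw [h] at hPQ
    exact Measure.absolutelyContinuous_zero_iff.1 hPQ)⟩
  have hc0 : (Q univ)⁻¹ ≠ 0 := ENNReal.inv_ne_zero.2 (measure_ne_top _ _)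
  have hprob : IsProbabilityMeasure ((Q univ)⁻¹ • Q) := inferInstance
  refine ⟨(Q univ)⁻¹ • Q, hprob, (Measure.smul_absolutelyContinuous).trans hQP,
    hPQ.trans (Measure.absolutelyContinuous_smul hc0), fun s hs i =>
    condExp_ae_eq_of_integral_gain_eq_zero hF hle hS (fun r hr θ hθ hθb => ?_) hs i⟩
  rw [integral_smul_measure, hQ r (by omega) hr θ hθ hθb, smul_zero]

end FundamentalTheorem

/-- Proposition 5.5.  A pricing process `S ∈ 𝒮` satisfies the no-arbitrage
condition (NA) iff `𝒬^e(S) ≠ ∅`, i.e. iff there exists a probability measure equivalent to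
`P` under which `S` is a martingale. -/
theorem statement7 [MeasurableSpace Ω] (F : ℕ → MeasurableSpace Ω) (P : Measure Ω)
    [IsProbabilityMeasure P] (d T : ℕ) (K : ℕ → Ω → Set (Fin d → ℝ))
    (hFil : FiltrationOK F P T) (hK : ConesOK K) (hKbar : FrictionAssumption P T K)
    (S : ℕ → Ω → Fin d → ℝ) (hS : memS F d T K S) :
    NoArb F P d T S ↔ (QeS F P d T S).Nonempty := by
  obtain ⟨hmono, hle, -, -⟩ := hFil
  have hF : Monotone F := fun s t => hmono s t
  have hSL : ∀ t ≤ T, S t ∈ LinfD F d t := fun t ht => (hS t ht).1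
  have hbayes : ∀ Q : Measure Ω, IsProbabilityMeasure Q → Q ≪ P → P ≪ Q → ∀ s, ∀ i : Fin d,
      EQcond F P Q s (fun ω => S T ω i) =ᵐ[P] Q[fun ω => S T ω i | F s] :=
    fun Q _ hQP hPQ s i => EQcond_ae_eq_condExp (hle s) hQP hPQ
      ((LinfD.apply (hSL T le_rfl) i).1.mono (hle T) le_rfl) (LinfD.apply (hSL T le_rfl) i).2
  constructor
  · intro hNA
    obtain ⟨Q, hQ, hQP, hPQ, hQS⟩ := hNA.exists_condExp_ae_eq hF hle hSL
      fun t ht => (hS t ht).2.2.1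
    exact ⟨Q, hQ, hQP, hPQ, fun s hs i =>
      ((hbayes Q hQ hQP hPQ s i).trans (hPQ.ae_le (hQS s hs i))).symm⟩
  · rintro ⟨Q, hQ, hQP, hPQ, hQS⟩
    exact noArb_of_condExp_ae_eq hQP hPQ hF hle hSL fun s hs i =>
      hQP.ae_le ((hQS s hs i).trans (hbayes Q hQ hQP hPQ s i)).symm

end RiskPaper
end
end

section
/- Let S ∈ 𝒮 and fix a time t. Then π_t^S(X) ∈ L^∞(F_t) for every X ∈ L^∞_d(F) if and only if π_t^S(0) ∈ L^∞(F_t). -/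
open MeasureTheory Filter Set
open scoped ENNReal

noncomputable section

namespace RiskPaper

variable {Ω : Type*}

section EssSup

/-- A nonempty family of measurable functions has a sequence whose pointwise supremum dominates
every member of the family almost everywhere. -/
theorem exists_seq_ae_le_iSup [MeasurableSpace Ω] {P : Measure Ω} [IsFiniteMeasure P]
    {B : Set (Ω → EReal)} (hB : ∀ f ∈ B, Measurable f) (hne : B.Nonempty) :
    ∃ u : ℕ → Ω → EReal, (∀ n, u n ∈ B) ∧ ∀ f ∈ B, ∀ᵐ ω ∂P, f ω ≤ ⨆ n, u n ω := by
  obtain ⟨f₀, hf₀⟩ := hne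
  let φ : EReal → ℝ≥0∞ := fun x => ENNReal.orderIsoIicOneBirational (EReal.exp x)
  have hφ : StrictMono φ := fun a b hab =>
    ENNReal.orderIsoIicOneBirational.strictMono (EReal.exp_strictMono hab)
  have hφ1 (x : EReal) : φ x ≤ 1 := (ENNReal.orderIsoIicOneBirational (EReal.exp x)).2
  have hφm : Measurable φ := hφ.monotone.measurable
  let I : (Ω → EReal) → ℝ≥0∞ := fun g => ∫⁻ ω, φ (g ω) ∂P
  have hImono {g h : Ω → EReal} (hgh : ∀ ω, g ω ≤ h ω) : I g ≤ I h :=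
    lintegral_mono fun ω => hφ.monotone (hgh ω)
  have hIfin (g : Ω → EReal) : I g ≠ ∞ := by
    refine ne_top_of_le_ne_top (measure_ne_top P univ) ?_
    calc I g ≤ ∫⁻ _, 1 ∂P := lintegral_mono fun ω => hφ1 _
      _ = P univ := by simp
  let V : Set ℝ≥0∞ := {c | ∃ u : ℕ → Ω → EReal, (∀ n, u n ∈ B) ∧ c = I fun ω => ⨆ n, u n ω}
  have hV : V.Nonempty := ⟨_, fun _ => f₀, fun _ => hf₀, rfl⟩
  obtain ⟨c, -, hc, hcV⟩ := exists_seq_tendsto_sSup hV (OrderTop.bddAbove V)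
  choose u hu hcu using hcV
  let w : ℕ → Ω → EReal := fun n => u n.unpair.1 n.unpair.2
  have hw (n : ℕ) : w n ∈ B := hu _ _
  have hwu (k : ℕ) (ω : Ω) : ⨆ n, u k n ω ≤ ⨆ n, w n ω :=
    iSup_le fun n => le_iSup_of_le (Nat.pair k n) (by simp [w])
  have hmax : sSup V ≤ I fun ω => ⨆ n, w n ω :=
    le_of_tendsto' hc fun k => (hcu k).trans_le (hImono (hwu k))
  refine ⟨w, hw, fun f hf => ?_⟩
  let v : ℕ → Ω → EReal := fun n => Nat.casesOn n f w
  have hv (n : ℕ) : v n ∈ B := by cases n with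
    | zero => exact hf
    | succ n => exact hw n
  have hwv (ω : Ω) : ⨆ n, w n ω ≤ ⨆ n, v n ω :=
    iSup_le fun n => le_iSup_of_le (n + 1) le_rfl
  have hvm : Measurable fun ω => ⨆ n, v n ω := .iSup fun n => hB _ (hv n)
  have hvI : I (fun ω => ⨆ n, v n ω) ≤ I fun ω => ⨆ n, w n ω :=
    (le_sSup (show _ ∈ V from ⟨v, hv, rfl⟩)).trans hmax
  have key := ae_eq_of_ae_le_of_lintegral_le (μ := P)
    (.of_forall fun ω => hφ.monotone (hwv ω)) (hIfin _) (hφm.comp hvm).aemeasurable hvI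
  filter_upwards [key] with ω hω
  rw [hφ.injective hω]
  exact le_iSup_of_le 0 le_rfl

/-- The essential supremum of a family of functions having `m`-measurable versions has an
`m`-measurable version. -/
theorem IsEssSupSetE.exists_measurable {m : MeasurableSpace Ω} [m0 : MeasurableSpace Ω]
    (hm : m ≤ m0) {P : Measure Ω} [IsFiniteMeasure P] {A : Set (Ω → EReal)} {g : Ω → EReal}
    (hA : ∀ f ∈ A, ∃ f', Measurable[m] f' ∧ f =ᵐ[P] f') (hg : IsEssSupSetE P A g) :
    ∃ g', Measurable[m] g' ∧ g =ᵐ[P] g' := by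
  let B : Set (Ω → EReal) := {f' | Measurable[m] f' ∧ ∃ f ∈ A, f =ᵐ[P] f'}
  rcases A.eq_empty_or_nonempty with rfl | ⟨f₀, hf₀⟩
  · refine ⟨fun _ => ⊥, @measurable_const _ _ _ m _, ?_⟩
    filter_upwards [hg.2 (fun _ => ⊥) (by simp)] with ω hω
    exact le_bot_iff.1 hω
  · obtain ⟨f₁, hf₁, h₀₁⟩ := hA f₀ hf₀
    obtain ⟨u, hu, hle⟩ := exists_seq_ae_le_iSup (P := P) (B := B)
      (fun f hf => hf.1.mono hm le_rfl) ⟨f₁, hf₁, f₀, hf₀, h₀₁⟩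
    refine ⟨fun ω => ⨆ n, u n ω, Measurable.iSup fun n => (hu n).1, ?_⟩
    have h1 : ∀ᵐ ω ∂P, g ω ≤ ⨆ n, u n ω := by
      refine hg.2 _ fun f hf => ?_
      obtain ⟨f', hf', hff'⟩ := hA f hf
      filter_upwards [hff', hle f' ⟨hf', f, hf, hff'⟩] with ω h h'
      rwa [h]
    have h2 : ∀ᵐ ω ∂P, ∀ n, u n ω ≤ g ω := by
      refine ae_all_iff.2 fun n => ?_
      obtain ⟨-, f, hf, hfu⟩ := hu n
      filter_upwards [hfu, hg.1 f hf] with ω h h'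
      rwa [← h]
    filter_upwards [h1, h2] with ω h h'
    exact le_antisymm h (iSup_le h')

end EssSup

section ConditionalExpectation

variable [m0 : MeasurableSpace Ω] {F : ℕ → MeasurableSpace Ω} {P Q : Measure Ω} {t : ℕ}

theorem xiBar_nonneg (ω : Ω) : 0 ≤ xiBar F P Q t ω := by
  unfold xiBar rnd
  split_ifs with h
  · exact div_nonneg ENNReal.toReal_nonneg h.le
  · exact zero_le_one

/-- If `E[ξ | m] ≤ 1` on the `m`-measurable set `A`, then `E[ξ x | m]` is bounded on `A` by any
bound of `|x|`. -/
theorem abs_condExp_mul_le_on {m : MeasurableSpace Ω} (hm : m ≤ m0) {ξ x : Ω → ℝ} {M : ℝ}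
    (hξ : ∀ ω, 0 ≤ ξ ω) (hx : ∀ ω, |x ω| ≤ M) (hM : 0 ≤ M) {A : Set Ω}
    (hA : MeasurableSet[m] A) (hint : Integrable (A.indicator ξ) P)
    (hle : ∀ᵐ ω ∂P, (P[A.indicator ξ | m]) ω ≤ 1) :
    ∀ᵐ ω ∂P, ω ∈ A → |(P[fun ω => ξ ω * x ω | m]) ω| ≤ M := by
  by_cases hi : Integrable (fun ω => ξ ω * x ω) P
  swap
  · rw [condExp_of_not_integrable hi]
    exact .of_forall fun ω _ => by simpa using hM
  have hiA := hi.indicator (hm _ hA)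
  have hup : P[A.indicator fun ω => ξ ω * x ω | m] ≤ᵐ[P] P[M • A.indicator ξ | m] := by
    refine condExp_mono hiA (hint.smul M) (.of_forall fun ω => ?_)
    by_cases h : ω ∈ A
    · simp only [indicator_of_mem h, Pi.smul_apply, smul_eq_mul]
      nlinarith [hξ ω, (abs_le.1 (hx ω)).2]
    · simp [h]
  have hlo : P[(-M) • A.indicator ξ | m] ≤ᵐ[P] P[A.indicator fun ω => ξ ω * x ω | m] := by
    refine condExp_mono (hint.smul (-M)) hiA (.of_forall fun ω => ?_)
    by_cases h : ω ∈ A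
    · simp only [indicator_of_mem h, Pi.smul_apply, smul_eq_mul]
      nlinarith [hξ ω, (abs_le.1 (hx ω)).1]
    · simp [h]
  filter_upwards [hup, hlo, condExp_smul M (A.indicator ξ) m (μ := P),
    condExp_smul (-M) (A.indicator ξ) m (μ := P), condExp_indicator hi hA, hle]
    with ω h1 h2 h3 h4 h5 h6 hω
  rw [h5, indicator_of_mem hω] at h1 h2
  rw [h3] at h1
  rw [h4] at h2
  simp only [Pi.smul_apply, smul_eq_mul] at h1 h2
  rw [abs_le]
  constructor <;> nlinarith

/-- `E^Q[x | F_t]` is bounded by any bound of `|x|`. -/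
theorem abs_EQcond_le [IsFiniteMeasure P] [IsFiniteMeasure Q] (hm : F t ≤ m0) {x : Ω → ℝ} {M : ℝ}
    (hx : ∀ ω, |x ω| ≤ M) (hM : 0 ≤ M) : ∀ᵐ ω ∂P, |EQcond F P Q t x ω| ≤ M := by
  set D : Ω → ℝ := P[rnd P Q | F t] with hD
  have hDm : Measurable[F t] D := stronglyMeasurable_condExp.measurable
  have hr : Integrable (rnd P Q) P := Measure.integrable_toReal_rnDeriv
  have hneg : ∀ᵐ ω ∂P, ω ∈ {ω | D ω ≤ 0} → |EQcond F P Q t x ω| ≤ M := by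
    have hA : MeasurableSet[F t] {ω | D ω ≤ 0} := hDm measurableSet_Iic
    have hind : {ω | D ω ≤ 0}.indicator (xiBar F P Q t)
        = {ω | D ω ≤ 0}.indicator fun _ => (1 : ℝ) := by
      refine indicator_congr fun ω hω => ?_
      exact if_neg (not_lt.2 hω)
    have hsm : StronglyMeasurable[F t] ({ω | D ω ≤ 0}.indicator fun _ => (1 : ℝ)) :=
      stronglyMeasurable_const.indicator hA
    have hint : Integrable ({ω | D ω ≤ 0}.indicator fun _ => (1 : ℝ)) P :=
      (integrable_const 1).indicator (hm _ hA)
    refine abs_condExp_mul_le_on hm xiBar_nonneg hx hM hA (hind ▸ hint) ?_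
    rw [hind, condExp_of_stronglyMeasurable hm hsm hint]
    exact .of_forall fun ω => indicator_le_self' (fun _ _ => zero_le_one) ω
  have hpos (n : ℕ) : ∀ᵐ ω ∂P,
      ω ∈ {ω | ((n : ℝ) + 1)⁻¹ < D ω} → |EQcond F P Q t x ω| ≤ M := by
    set A : Set Ω := {ω | ((n : ℝ) + 1)⁻¹ < D ω} with hAdef
    have hn : (0 : ℝ) < ((n : ℝ) + 1)⁻¹ := by positivity
    have hA : MeasurableSet[F t] A := hDm measurableSet_Ioi
    have hind : A.indicator (xiBar F P Q t) = (A.indicator fun ω => (D ω)⁻¹) * rnd P Q := by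
      ext ω
      by_cases h : ω ∈ A
      · have h0 : 0 < D ω := hn.trans h
        simp only [indicator_of_mem h, Pi.mul_apply, xiBar]
        rw [if_pos h0, ← hD, div_eq_inv_mul]
      · simp [h]
    have hwm : StronglyMeasurable[F t] (A.indicator fun ω => (D ω)⁻¹) :=
      hDm.inv.stronglyMeasurable.indicator hA
    have hint : Integrable ((A.indicator fun ω => (D ω)⁻¹) * rnd P Q) P := by
      refine hr.bdd_mul (c := (n : ℝ) + 1) (hwm.mono hm).aestronglyMeasurable
        (.of_forall fun ω => ?_)
      by_cases h : ω ∈ A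
      · rw [indicator_of_mem h, norm_inv, Real.norm_of_nonneg (hn.trans h).le]
        exact inv_le_of_inv_le₀ (by positivity) (le_of_lt h)
      · simp only [indicator_of_notMem h, norm_zero]
        positivity
    refine abs_condExp_mul_le_on hm xiBar_nonneg hx hM hA (hind ▸ hint) ?_
    rw [hind]
    filter_upwards [condExp_mul_of_stronglyMeasurable_left hwm hint hr] with ω hω
    rw [hω, Pi.mul_apply, ← hD]
    by_cases h : ω ∈ A
    · rw [indicator_of_mem h, inv_mul_cancel₀ (hn.trans h).ne']
    · simp [h]
  filter_upwards [hneg, ae_all_iff.2 hpos] with ω h1 h2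
  rcases le_or_gt (D ω) 0 with h | h
  · exact h1 h
  · obtain ⟨n, hn⟩ := exists_nat_one_div_lt h
    exact h2 n (by simpa using hn)

theorem measurable_EQcond (x : Ω → ℝ) : Measurable[F t] (EQcond F P Q t x) :=
  stronglyMeasurable_condExp.measurable

end ConditionalExpectation

theorem exists_abs_dot_le {d : ℕ} {F : ℕ → MeasurableSpace Ω} {s t : ℕ} {X Y : Ω → Fin d → ℝ}
    (hX : X ∈ LinfD F d s) (hY : Y ∈ LinfD F d t) :
    ∃ M : ℝ, 0 ≤ M ∧ ∀ ω, |dot (X ω) (Y ω)| ≤ M := by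
  obtain ⟨-, B, hB⟩ := hX
  obtain ⟨-, C, hC⟩ := hY
  refine ⟨∑ _i : Fin d, |B| * |C|, Finset.sum_nonneg fun _ _ => by positivity, fun ω => ?_⟩
  refine (Finset.abs_sum_le_sum_abs _ _).trans (Finset.sum_le_sum fun i _ => ?_)
  rw [abs_mul]
  exact mul_le_mul ((hB ω i).trans (le_abs_self B)) ((hC ω i).trans (le_abs_self C))
    (abs_nonneg _) (abs_nonneg _)

theorem EReal_sub_coe_le_add_coe {a g : EReal} {x y M : ℝ} (h : a - (y : EReal) ≤ g)
    (hxy : y - x ≤ M) : a - (x : EReal) ≤ g + (M : EReal) := by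
  have heq : a - (x : EReal) = a - (y : EReal) + ((y - x : ℝ) : EReal) := by
    induction a with
    | bot => simp
    | top => simp [sub_eq_add_neg, ← EReal.coe_neg]
    | coe a => norm_cast; ring
  rw [heq]
  exact add_le_add h (EReal.coe_le_coe_iff.2 hxy)

section Pi

variable [m0 : MeasurableSpace Ω] {F : ℕ → MeasurableSpace Ω} {P : Measure Ω}
  [IsProbabilityMeasure P] {d T t : ℕ} {S : ℕ → Ω → Fin d → ℝ} {beta : Measure Ω → Ω → EReal}

theorem IsPenalty.exists_measurable (hm : F t ≤ m0) {A : Set (Ω → Fin d → ℝ)} {Q : Measure Ω}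
    {b : Ω → EReal} (h : IsPenalty F P d T t A Q S b) :
    ∃ b', Measurable[F t] b' ∧ b =ᵐ[P] b' := by
  refine IsEssSupSetE.exists_measurable hm ?_ h
  rintro _ ⟨Z, -, rfl⟩
  exact ⟨_, measurable_coe_real_ereal.comp (measurable_EQcond _).neg, .rfl⟩

theorem IsPi.exists_measurable (hm : F t ≤ m0)
    (hbeta : ∀ Q ∈ QeS F P d T S, ∃ b', Measurable[F t] b' ∧ beta Q =ᵐ[P] b')
    {X : Ω → Fin d → ℝ} {g : Ω → EReal} (h : IsPi F P d T t beta S X g) :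
    ∃ g', Measurable[F t] g' ∧ g =ᵐ[P] g' := by
  refine IsEssSupSetE.exists_measurable hm ?_ h
  rintro _ ⟨Q, hQ, rfl⟩
  obtain ⟨b', hb', hbb'⟩ := hbeta Q hQ
  refine ⟨fun ω => -b' ω +
    ((-EQcond F P Q t (fun ω' => dot (S T ω') (X ω')) ω : ℝ) : EReal), ?_, ?_⟩
  · exact (continuous_neg.measurable.comp hb').add
      (measurable_coe_real_ereal.comp (measurable_EQcond _).neg)
  · filter_upwards [hbb'] with ω hω
    rw [hω, sub_eq_add_neg, EReal.coe_neg]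

/-- `π_t^S(X)` exceeds `π_t^S(Y)` by at most a constant. -/
theorem IsPi.exists_le_add (hm : F t ≤ m0) {s : ℕ} (hS : S T ∈ LinfD F d T)
    {X Y : Ω → Fin d → ℝ} (hX : X ∈ LinfD F d s) (hY : Y ∈ LinfD F d s) {f g : Ω → EReal}
    (hf : IsPi F P d T t beta S X f) (hg : IsPi F P d T t beta S Y g) :
    ∃ M : ℝ, ∀ᵐ ω ∂P, f ω ≤ g ω + (M : EReal) := by
  obtain ⟨M₁, hM₁, h₁⟩ := exists_abs_dot_le hS hX
  obtain ⟨M₂, hM₂, h₂⟩ := exists_abs_dot_le hS hY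
  refine ⟨M₂ + M₁, hf.2 _ ?_⟩
  rintro _ ⟨Q, hQ, rfl⟩
  have := hQ.1
  filter_upwards [hg.1 _ ⟨Q, hQ, rfl⟩, abs_EQcond_le (P := P) (Q := Q) hm h₁ hM₁,
    abs_EQcond_le (P := P) (Q := Q) hm h₂ hM₂] with ω h hx hy
  exact EReal_sub_coe_le_add_coe h (by linarith [(abs_le.1 hx).1, (abs_le.1 hy).2])

end Pi

/-- A function with an `F_t`-measurable version lying between two real constants belongs to
`L^∞(F_t)`. -/
theorem memLinfE_of_bounds [MeasurableSpace Ω] {F : ℕ → MeasurableSpace Ω} {P : Measure Ω}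
    {t : ℕ} {g g' : Ω → EReal} (hg' : Measurable[F t] g') (hgg' : g =ᵐ[P] g') {a b : ℝ}
    (hab : ∀ᵐ ω ∂P, (a : EReal) ≤ g ω ∧ g ω ≤ (b : EReal)) : MemLinfE F P t g := by
  have hme : Measurable[F t] fun ω => (g' ω).toReal := measurable_ereal_toReal.comp hg'
  refine ⟨fun ω => max a (min b (g' ω).toReal), ⟨?_, |a| + |b|, fun ω => ?_⟩, ?_⟩
  · exact (measurable_const.max (measurable_const.min measurable_id)).comp hme
  · rw [abs_le]
    constructor
    · linarith [neg_abs_le a, abs_nonneg b, le_max_left a (min b (g' ω).toReal)]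
    · exact max_le (by linarith [le_abs_self a, abs_nonneg b])
        ((min_le_left _ _).trans (by linarith [le_abs_self b, abs_nonneg a]))
  · filter_upwards [hgg', hab] with ω h ⟨h1, h2⟩
    rw [← h]
    have hcoe : ((g ω).toReal : EReal) = g ω :=
      EReal.coe_toReal (ne_top_of_le_ne_top (EReal.coe_ne_top b) h2)
        (ne_bot_of_le_ne_bot (EReal.coe_ne_bot a) h1)
    rw [← hcoe, EReal.coe_le_coe_iff] at h1 h2
    rw [min_eq_right h2, max_eq_right h1, hcoe]

/-- Proposition 5.8.  For `S ∈ 𝒮` and a fixed time `t`: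
`π_t^S(X) ∈ L^∞(F_t)` for every `X ∈ L^∞_d(F)` iff `π_t^S(0) ∈ L^∞(F_t)`. -/
theorem statement9 [MeasurableSpace Ω] (F : ℕ → MeasurableSpace Ω) (P : Measure Ω)
    [IsProbabilityMeasure P] (d T t : ℕ) (ht : t ≤ T) (K : ℕ → Ω → Set (Fin d → ℝ))
    (hFil : FiltrationOK F P T) (hK : ConesOK K) (hKbar : FrictionAssumption P T K)
    (rho : (Ω → Fin d → ℝ) → Ω → ℝ)
    (hrho : ScalarRM F P d T t rho) (hKcomp : KCompat F P d T K t rho)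
    (hFatou : Fatou F P d T rho) (hRel : Relevant P d rho)
    -- `beta Q` is a version of the penalty `β_t(Q,S)`:
    (beta : Measure Ω → Ω → EReal)
    (S : ℕ → Ω → Fin d → ℝ) (hS : memS F d T K S)
    (hbeta : ∀ Q ∈ QeS F P d T S, IsPenalty F P d T t (Acc F P d T rho) Q S (beta Q))
    -- `pi X` is a version of `π_t^S(X)`:
    (pi : (Ω → Fin d → ℝ) → Ω → EReal)
    (hpi : ∀ X ∈ LinfD F d T, IsPi F P d T t beta S X (pi X)) :
    (∀ X ∈ LinfD F d T, MemLinfE F P t (pi X)) ↔ MemLinfE F P t (pi fun _ _ => 0) := by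
  have hm := hFil.2.1 t
  have h0 : (fun _ _ => 0 : Ω → Fin d → ℝ) ∈ LinfD F d T :=
    ⟨@measurable_const _ _ _ (F T) _, 0, by simp⟩
  refine ⟨fun h => h _ h0, fun ⟨x, ⟨_, C, hC⟩, hx⟩ X hX => ?_⟩
  obtain ⟨g', hg', hgg'⟩ := (hpi X hX).exists_measurable hm fun Q hQ =>
    (hbeta Q hQ).exists_measurable hm
  have hST := (hS T le_rfl).1
  obtain ⟨M₁, h₁⟩ := (hpi X hX).exists_le_add hm hST hX h0 (hpi _ h0)
  obtain ⟨M₂, h₂⟩ := (hpi _ h0).exists_le_add hm hST h0 hX (hpi X hX)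
  refine memLinfE_of_bounds hg' hgg' (a := -C - M₂) (b := C + M₁) ?_
  filter_upwards [hx, h₁, h₂] with ω hω h1 h2
  rw [hω] at h1 h2
  obtain ⟨hl, hu⟩ := abs_le.1 (hC ω)
  constructor
  · rw [EReal.coe_sub]
    exact EReal.sub_le_of_le_add ((EReal.coe_le_coe_iff.2 hl).trans h2)
  · refine h1.trans ?_
    rw [← EReal.coe_add, EReal.coe_le_coe_iff]
    linarith

end RiskPaper
end
end
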